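/- arXiv:2506.00529 — 2 statements merged into one kernel-verified Lean document; each statement's English description precedes it below -/
import Mathlib

section
/- Let (R, 𝔪) be a commutative Noetherian local ring, r ≥ 1 an integer, I_1,…,I_r ideals of R, and N ⊆ M finitely generated R-modules. Let f : K → L be an R-linear map between finitely generated R-modules and let F denote the associated coherent functor, F(X) := Hom_R(K,X) / {g ∘ f : g ∈ Hom_R(L,X)}. Then the projective dimension of F(M/I^n N) is eventually constant: there exists c ∈ ℕ^r such that for all n ≥ c, pd_R(F(M/I^n N)) = pd_R(F(M/I^c N)) as elements of ℕ ∪ {∞} (with the convention that the zero module has every projective dimension bound). -/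
universe u

open CategoryTheory

/-- The value of the coherent functor presented by `f : K →ₗ[R] L` on a module `X`:
`F(X) = Hom_R(K, X) / {g ∘ f : g ∈ Hom_R(L, X)}`. -/
abbrev coherentApply {R K L : Type u} [CommRing R] [AddCommGroup K] [Module R K]
    [AddCommGroup L] [Module R L] (f : K →ₗ[R] L)
    (X : Type u) [AddCommGroup X] [Module R X] : Type u :=
  (K →ₗ[R] X) ⧸ LinearMap.range (LinearMap.lcomp R X f)

/-- The product ideal `I^n = I_1^{n_1} ⋯ I_r^{n_r}`. -/
abbrev prodPow {R : Type u} [CommRing R] {r : ℕ} (I : Fin r → Ideal R)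
    (n : Fin r → ℕ) : Ideal R :=
  ∏ i, I i ^ n i

/-- The projective dimension `pd_R(X) ∈ ℕ ∪ {∞}` of an `R`-module `X`: the least
`m ∈ ℕ` such that `Ext_R^{m+1}(X, Y) = 0` for every `R`-module `Y` (equivalently, the
least length of a projective resolution of `X`), and `⊤` if there is no such `m`.
With this convention the zero module has projective dimension `0` (it satisfies every
projective dimension bound). -/
noncomputable def projDim (R : Type u) [CommRing R]
    (X : Type u) [AddCommGroup X] [Module R X] : ℕ∞ :=
  sInf {n : ℕ∞ | ∃ m : ℕ, n = m ∧ ∀ Y : ModuleCat.{u} R,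
    Subsingleton ↥(((Ext R (ModuleCat.{u} R) (m + 1)).obj
      (Opposite.op (ModuleCat.of R X))).obj Y)}


theorem hpd_of_ext {R : Type u} [CommRing R] (m : ℕ) (X : ModuleCat.{u} R)
    (h : ∀ Y : ModuleCat.{u} R, Subsingleton (Abelian.Ext X Y (m + 1))) :
    HasProjectiveDimensionLE X m := by
  induction m generalizing X with
  | zero =>
    rw [← projective_iff_hasProjectiveDimensionLE_zero, projective_iff_subsingleton_ext_one]
    exact fun {Y} => h Y
  | succ m ih =>
    have hS := X.shortExact_projectiveShortComplex
    have hp : Projective X.projectiveShortComplex.X₂ :=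
      (IsProjective.iff_projective _).1 inferInstance
    refine (hS.hasProjectiveDimensionLT_X₃_iff m hp).2 (ih _ fun Y => ?_)
    refine subsingleton_of_forall_eq 0 fun x => ?_
    obtain ⟨y, hy⟩ := Abelian.Ext.contravariant_sequence_exact₁ hS Y x (n₁ := m + 1 + 1)
      (by omega) (@Subsingleton.elim _ (h Y) _ _)
    rw [← hy, Abelian.Ext.eq_zero_of_projective y, Abelian.Ext.comp_zero]

theorem ext_subsingleton_iff {R : Type u} [CommRing R] (m : ℕ) (X Y : ModuleCat.{u} R) :
    Subsingleton ↥(((Ext R (ModuleCat.{u} R) (m + 1)).obj (Opposite.op X)).obj Y) ↔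
      Subsingleton (Abelian.Ext X Y (m + 1)) := by
  let P := ProjectiveResolution.of X
  have key : Subsingleton (Abelian.Ext X Y (m + 1)) ↔
      ∀ f : P.complex.X (m + 1) ⟶ Y, P.complex.d (m + 2) (m + 1) ≫ f = 0 →
        ∃ g : P.complex.X m ⟶ Y, P.complex.d (m + 1) m ≫ g = f := by
    constructor
    · intro h f hf
      exact (P.extMk_eq_zero_iff f (m + 2) rfl hf m rfl).1 (Subsingleton.elim _ _)
    · intro h
      refine subsingleton_of_forall_eq 0 fun x => ?_
      obtain ⟨f, hf, rfl⟩ := P.extMk_surjective x (m + 2) rfl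
      exact (P.extMk_eq_zero_iff f (m + 2) rfl hf m rfl).2 (h f hf)
  rw [key, (P.isoExt (R := R) (m + 1) Y).toLinearEquiv.toEquiv.subsingleton_congr,
    ← ModuleCat.isZero_iff_subsingleton (R := R), 
    ← HomologicalComplex.exactAt_iff_isZero_homology,
    HomologicalComplex.exactAt_iff' _ m (m + 1) (m + 2) (by simp) (by simp),
    ShortComplex.moduleCat_exact_iff]
  rfl

theorem ext_iff_hpd {R : Type u} [CommRing R] (m : ℕ) (X : ModuleCat.{u} R) :
    (∀ Y : ModuleCat.{u} R, Subsingleton ↥(((Ext R (ModuleCat.{u} R) (m + 1)).obj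
      (Opposite.op X)).obj Y)) ↔ HasProjectiveDimensionLE X m := by
  simp only [ext_subsingleton_iff]
  exact ⟨hpd_of_ext m X, fun h Y => HasProjectiveDimensionLT.subsingleton X (m+1) _ le_rfl Y⟩



/-- projective dimension at most m -/
def PdLE (R : Type u) [CommRing R] (m : ℕ) (X : Type u) [AddCommGroup X] [Module R X] : Prop :=
  HasProjectiveDimensionLE (ModuleCat.of R X) m

theorem pdLE_zero {R : Type u} [CommRing R] (X : Type u) [AddCommGroup X] [Module R X] :
    PdLE R 0 X ↔ Module.Projective R X := by
  rw [PdLE, ← projective_iff_hasProjectiveDimensionLE_zero, ← IsProjective.iff_projective]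

theorem pdLE_mono {R : Type u} [CommRing R] {m m' : ℕ} (h : m ≤ m')
    (X : Type u) [AddCommGroup X] [Module R X] (hX : PdLE R m X) : PdLE R m' X :=
  @hasProjectiveDimensionLT_of_ge _ _ _ _ (m+1) (m'+1) (by omega) hX

theorem pdLE_succ {R : Type u} [CommRing R] (m : ℕ) {F X : Type u} [AddCommGroup X] [Module R X]
    [AddCommGroup F] [Module R F] [Module.Free R F] (g : F →ₗ[R] X) (hg : Function.Surjective g) :
    PdLE R (m + 1) X ↔ PdLE R m (LinearMap.ker g) := by
  have hp : Projective g.shortComplexKer.X₂ :=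
      (IsProjective.iff_projective _).1 (inferInstanceAs (Module.Projective R F))
  exact (LinearMap.shortExact_shortComplexKer hg).hasProjectiveDimensionLT_X₃_iff m hp

theorem exists_cover (R : Type u) [CommRing R] (X : Type u) [AddCommGroup X] [Module R X]
    [Module.Finite R X] : ∃ (a : ℕ) (g : (Fin a → R) →ₗ[R] X), Function.Surjective g :=
  Module.Finite.exists_fin' R X

theorem exists_test {R : Type u} [CommRing R] [IsNoetherianRing R] [IsLocalRing R] (m : ℕ) :
    ∃ (P : Type u) (_ : AddCommGroup P) (_ : Module R P) (_ : Module.Finite R P)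
      (_ : Module.Free R P) (C : Submodule R P),
      ∀ (X : Type u) [AddCommGroup X] [Module R X] [Module.Finite R X],
        PdLE R m X ↔ Function.Injective (C.subtype.rTensor X) := by
  induction m with
  | zero =>
    refine ⟨R, inferInstance, inferInstance, inferInstance, inferInstance,
      IsLocalRing.maximalIdeal R, fun X _ _ _ => ?_⟩
    rw [pdLE_zero]
    constructor
    · intro h
      exact Module.Flat.rTensor_preserves_injective_linearMap _ Subtype.val_injective
    · intro h
      have := Module.finitePresentation_of_finite R X
      have := Module.free_of_maximalIdeal_rTensor_injective h
      infer_instance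
  | succ m ih =>
    obtain ⟨P, _, _, _, _, C, hC⟩ := ih
    obtain ⟨b, q, hq⟩ := exists_cover R C
    refine ⟨Fin b → R, inferInstance, inferInstance, inferInstance, inferInstance,
      LinearMap.ker q, fun X _ _ _ => ?_⟩
    obtain ⟨a, g, hg⟩ := exists_cover R X
    rw [pdLE_succ m g hg, hC]
    have e1 : Function.Exact (LinearMap.ker q).subtype q := LinearMap.exact_subtype_ker_map q
    have e2 : Function.Exact (LinearMap.ker g).subtype g := LinearMap.exact_subtype_ker_map g
    have step1 : Function.Injective ((LinearMap.ker q).subtype.rTensor X) ↔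
        Function.Injective ((LinearMap.ker g).subtype.lTensor C) := by
      constructor
      · intro h
        exact lTensor_injective_of_exact_of_exact_of_rTensor_injective e1 hq e2 hg h
          (Module.Flat.lTensor_preserves_injective_linearMap _ Subtype.val_injective)
      · intro h
        rw [← LinearMap.lTensor_inj_iff_rTensor_inj]
        exact lTensor_injective_of_exact_of_exact_of_rTensor_injective e2 hg e1 hq
          ((LinearMap.lTensor_inj_iff_rTensor_inj _ _).1 h)
          (Module.Flat.lTensor_preserves_injective_linearMap _ Subtype.val_injective)
    rw [step1]
    have i1 : Function.Injective (C.subtype.rTensor (Fin a → R)) :=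
      Module.Flat.rTensor_preserves_injective_linearMap _ Subtype.val_injective
    have i2 : Function.Injective ((LinearMap.ker g).subtype.lTensor P) :=
      Module.Flat.lTensor_preserves_injective_linearMap _ Subtype.val_injective
    have comm : (C.subtype.rTensor (Fin a → R)) ∘ₗ ((LinearMap.ker g).subtype.lTensor C) =
        ((LinearMap.ker g).subtype.lTensor P) ∘ₗ (C.subtype.rTensor (LinearMap.ker g)) := by
      rw [LinearMap.rTensor_comp_lTensor, LinearMap.lTensor_comp_rTensor]
    rw [← i1.of_comp_iff, ← i2.of_comp_iff, ← LinearMap.coe_comp, ← LinearMap.coe_comp, comm]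



open RingTheory.Sequence in
theorem exists_max_regular (R : Type u) [CommRing R] [IsNoetherianRing R] [IsLocalRing R] :
    ∃ rs : List R, IsWeaklyRegular R rs ∧ ∃ s : R, s ∉ Ideal.ofList rs ∧
      ∀ a ∈ IsLocalRing.maximalIdeal R, a * s ∈ Ideal.ofList rs := by
  let 𝒮 : Set (Ideal R) := {J | ∃ rs : List R, IsWeaklyRegular R rs ∧
    (∀ x ∈ rs, x ∈ IsLocalRing.maximalIdeal R) ∧ J = Ideal.ofList rs}
  have hne : 𝒮.Nonempty := ⟨_, [], IsWeaklyRegular.nil _ _, by simp, rfl⟩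
  obtain ⟨J, ⟨rs, hrs, hm, rfl⟩, hmax⟩ := set_has_maximal_iff_noetherian.2 ‹_› 𝒮 hne
  refine ⟨rs, hrs, ?_⟩
  have hle : Ideal.ofList rs ≤ IsLocalRing.maximalIdeal R := Ideal.span_le.2 hm
  by_cases hsub : Subsingleton ((R ⧸ IsLocalRing.maximalIdeal R) →ₗ[R] (R ⧸ Ideal.ofList rs))
  · exfalso
    obtain ⟨x, hx, hreg⟩ := IsSMulRegular.subsingleton_linearMap_iff.1 hsub
    rw [Ideal.annihilator_quotient] at hx
    refine hmax (Ideal.ofList (rs ++ [x])) ⟨rs ++ [x], ?_, ?_, rfl⟩ ?_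
    · rw [isWeaklyRegular_append_iff]
      refine ⟨hrs, ?_⟩
      rw [isWeaklyRegular_singleton_iff]
      have e : (Ideal.ofList rs • ⊤ : Submodule R R) = Ideal.ofList rs := by simp
      rw [e]
      exact hreg
    · intro y hy
      rcases List.mem_append.1 hy with h | h
      · exact hm y h
      · rw [List.mem_singleton.1 h]; exact hx
    · rw [Ideal.ofList_append, Ideal.ofList_singleton]
      refine lt_of_le_of_ne le_sup_left fun h => ?_
      have hxm : x ∈ Ideal.ofList rs := by
        rw [h]
        exact Ideal.mem_sup_right (Ideal.mem_span_singleton_self x)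
      have h1 : x • (Ideal.Quotient.mk (Ideal.ofList rs) 1) = x • 0 := by
        rw [smul_zero, ← Ideal.Quotient.mk_eq_mk, ← Submodule.Quotient.mk_smul,
          Submodule.Quotient.mk_eq_zero]
        simpa using hxm
      have h2 := hreg h1
      rw [Ideal.Quotient.eq_zero_iff_mem] at h2
      exact (IsLocalRing.maximalIdeal.isMaximal R).ne_top ((Ideal.eq_top_iff_one _).2 (hle h2))
  · rw [not_subsingleton_iff_nontrivial] at hsub
    obtain ⟨φ, hφ⟩ := exists_ne (0 : (R ⧸ IsLocalRing.maximalIdeal R) →ₗ[R] (R ⧸ Ideal.ofList rs))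
    obtain ⟨s, hs⟩ := Ideal.Quotient.mk_surjective (φ 1)
    refine ⟨s, fun h => hφ ?_, fun a ha => ?_⟩
    · have : φ 1 = 0 := by rw [← hs, Ideal.Quotient.eq_zero_iff_mem]; exact h
      apply LinearMap.ext
      intro y
      obtain ⟨y, rfl⟩ := Ideal.Quotient.mk_surjective y
      have : (Ideal.Quotient.mk (IsLocalRing.maximalIdeal R) y) = y • 1 := by
        rw [Algebra.smul_def, mul_one]; rfl
      rw [this, map_smul, ‹φ 1 = 0›]; simp
    · rw [← Ideal.Quotient.eq_zero_iff_mem, map_mul, hs]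
      have h3 : Ideal.Quotient.mk (Ideal.ofList rs) a * φ 1 = a • φ 1 := by
        rw [Algebra.smul_def]; rfl
      rw [h3, ← map_smul]
      have : a • (1 : R ⧸ IsLocalRing.maximalIdeal R) = 0 := by
        rw [Algebra.smul_def, mul_one]
        exact Ideal.Quotient.eq_zero_iff_mem.2 ha
      rw [this, map_zero]

open RingTheory.Sequence in
theorem syz_inj {R : Type u} [CommRing R] {rs : List R} {F Y : Type u} [AddCommGroup F] [Module R F]
    [AddCommGroup Y] [Module R Y] (g : F →ₗ[R] Y) (hg : Function.Surjective g)
    (hY : IsWeaklyRegular Y rs) (z : LinearMap.ker g)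
    (hz : (z : F) ∈ (Ideal.ofList rs • ⊤ : Submodule R F)) :
    z ∈ (Ideal.ofList rs • ⊤ : Submodule R (LinearMap.ker g)) := by
  have h12 : Function.Exact (0 : PUnit.{u+1} →ₗ[R] LinearMap.ker g) (LinearMap.ker g).subtype := by
    rw [LinearMap.exact_zero_iff_injective]; exact Subtype.val_injective
  have := map_first_exact_on_four_term_right_exact_of_isSMulRegular_last h12
    (LinearMap.exact_subtype_ker_map g) hg hY
  have h := (this (Submodule.Quotient.mk z)).1 (by
    rw [Submodule.mapQ_apply, Submodule.Quotient.mk_eq_zero]; exact hz)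
  obtain ⟨w, hw⟩ := h
  obtain ⟨w, rfl⟩ := Submodule.Quotient.mk_surjective _ w
  rw [Submodule.mapQ_apply, LinearMap.zero_apply, Submodule.Quotient.mk_zero, eq_comm,
    Submodule.Quotient.mk_eq_zero] at hw
  exact hw

open RingTheory.Sequence in
theorem free_regular {R : Type u} [CommRing R] {rs : List R} (hR : IsWeaklyRegular R rs)
    (F : Type u) [AddCommGroup F] [Module R F] [Module.Flat R F] : IsWeaklyRegular F rs :=
  ((TensorProduct.rid R F).isWeaklyRegular_congr rs).1 hR.isWeaklyRegular_lTensor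

open RingTheory.Sequence in
theorem syz_regular {R : Type u} [CommRing R] {rs : List R} (hR : IsWeaklyRegular R rs)
    {F Y : Type u} [AddCommGroup F] [Module R F] [Module.Flat R F]
    [AddCommGroup Y] [Module R Y] (g : F →ₗ[R] Y) (hg : Function.Surjective g) (j : ℕ)
    (hY : ∀ i, i ≤ j → IsWeaklyRegular Y (rs.take i)) (i : ℕ) (hi : i ≤ j + 1) :
    IsWeaklyRegular (LinearMap.ker g) (rs.take i) := by
  constructor
  intro k hk
  rw [List.length_take] at hk
  have hF := (free_regular hR F).regular_mod_prev k (by omega)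
  rw [List.take_take, List.getElem_take, min_eq_left (by omega)]
  have hYk := hY k (by omega)
  rw [isSMulRegular_quotient_iff_mem_of_smul_mem] at hF ⊢
  intro z hz
  refine syz_inj g hg hYk z (hF _ ?_)
  exact Submodule.smul_top_le_comap_smul_top _ (LinearMap.ker g).subtype hz

open RingTheory.Sequence in
theorem proj_of_pd_one {R : Type u} [CommRing R] [IsNoetherianRing R] [IsLocalRing R] {rs : List R}
    {s : R} (hs : s ∉ Ideal.ofList rs)
    (hsm : ∀ a ∈ IsLocalRing.maximalIdeal R, a * s ∈ Ideal.ofList rs)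
    (X : Type u) [AddCommGroup X] [Module R X] [Module.Finite R X] (hX : IsWeaklyRegular X rs)
    (h1 : PdLE R 1 X) : PdLE R 0 X := by
  obtain ⟨a, g, hg⟩ := exists_cover R X
  rw [pdLE_succ 0 g hg, pdLE_zero] at h1
  have hfree : Module.Free R (LinearMap.ker g) := Module.free_of_flat_of_isLocalRing
  have key : ∀ z : LinearMap.ker g,
      (z : Fin a → R) ∈ (IsLocalRing.maximalIdeal R • ⊤ : Submodule R (Fin a → R)) →
      z ∈ (IsLocalRing.maximalIdeal R • ⊤ : Submodule R (LinearMap.ker g)) := by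
    intro z hz
    have h2 : s • z ∈ (Ideal.ofList rs • ⊤ : Submodule R (LinearMap.ker g)) := by
      refine syz_inj g hg hX _ ?_
      change s • (z : Fin a → R) ∈ _
      refine Submodule.smul_induction_on hz (fun r hr n _ => ?_) (fun x y hx hy => ?_)
      · rw [smul_smul, mul_comm]
        exact Submodule.smul_mem_smul (hsm r hr) trivial
      · rw [smul_add]; exact add_mem hx hy
    let b := Module.Free.chooseBasis R (LinearMap.ker g)
    have hc : ∀ (J : Ideal R) (y : LinearMap.ker g), y ∈ (J • ⊤ : Submodule R (LinearMap.ker g)) →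
        ∀ i, b.repr y i ∈ J := by
      intro J y hy i
      refine Submodule.smul_induction_on hy (fun r hr n _ => ?_) (fun x y hx hy => ?_)
      · rw [map_smul, Finsupp.smul_apply, smul_eq_mul]
        exact Ideal.mul_mem_right _ _ hr
      · rw [map_add, Finsupp.add_apply]; exact add_mem hx hy
    rw [← b.linearCombination_repr z, Finsupp.linearCombination_apply]
    refine Submodule.sum_mem _ fun i _ => Submodule.smul_mem_smul ?_ trivial
    rw [IsLocalRing.mem_maximalIdeal, mem_nonunits_iff]
    intro hu
    have h3 := hc _ _ h2 i
    rw [map_smul, Finsupp.smul_apply, smul_eq_mul] at h3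
    exact hs ((Ideal.mul_unit_mem_iff_mem _ hu).1 h3)
  rw [pdLE_zero]
  have : Module.Free R X := by
    refine Module.free_of_lTensor_residueField_injective (LinearMap.ker g).subtype g hg
      (LinearMap.exact_subtype_ker_map g) ?_
    rw [injective_iff_map_eq_zero]
    intro t ht
    obtain ⟨z, rfl⟩ := TensorProduct.mk_surjective R (LinearMap.ker g)
      (IsLocalRing.ResidueField R) IsLocalRing.residue_surjective t
    rw [TensorProduct.mk_apply, LinearMap.lTensor_tmul] at ht
    have h4 : (z : Fin a → R) ∈ (IsLocalRing.maximalIdeal R • ⊤ : Submodule R (Fin a → R)) := by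
      have := congrArg (TensorProduct.quotTensorEquivQuotSMul (Fin a → R)
        (IsLocalRing.maximalIdeal R)) ht
      have h5 := TensorProduct.quotTensorEquivQuotSMul_mk_tmul (IsLocalRing.maximalIdeal R) 1
        ((LinearMap.ker g).subtype z)
      have h7 := h5.symm.trans (this.trans (map_zero (TensorProduct.quotTensorEquivQuotSMul
        (Fin a → R) (IsLocalRing.maximalIdeal R))))
      rw [one_smul, Submodule.Quotient.mk_eq_zero] at h7
      exact h7
    have h6 := key z h4
    rw [TensorProduct.mk_apply]
    refine Submodule.smul_induction_on h6 (fun r hr n _ => ?_) (fun x y hx hy => ?_)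
    · rw [TensorProduct.tmul_smul, TensorProduct.smul_tmul']
      have : r • (1 : IsLocalRing.ResidueField R) = 0 := by
        rw [Algebra.smul_def, mul_one]
        exact Ideal.Quotient.eq_zero_iff_mem.2 hr
      rw [this, TensorProduct.zero_tmul]
    · rw [TensorProduct.tmul_add, hx, hy, add_zero]
  infer_instance

open RingTheory.Sequence in
theorem proj_of_pd {R : Type u} [CommRing R] [IsNoetherianRing R] [IsLocalRing R] {rs : List R}
    (hR : IsWeaklyRegular R rs)
    {s : R} (hs : s ∉ Ideal.ofList rs)
    (hsm : ∀ a ∈ IsLocalRing.maximalIdeal R, a * s ∈ Ideal.ofList rs) (m : ℕ)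
    (X : Type u) [AddCommGroup X] [Module R X] [Module.Finite R X]
    (hX : ∀ i, i ≤ rs.length → IsWeaklyRegular X (rs.take i))
    (h1 : PdLE R m X) : PdLE R 0 X := by
  induction m generalizing X with
  | zero => exact h1
  | succ m ih =>
    obtain ⟨a, g, hg⟩ := exists_cover R X
    have := ih (LinearMap.ker g)
      (fun i hi => syz_regular hR g hg rs.length hX i (by omega)) ((pdLE_succ m g hg).1 h1)
    exact proj_of_pd_one hs hsm X (by simpa using hX _ le_rfl) ((pdLE_succ 0 g hg).2 this)

open RingTheory.Sequence in
theorem exists_pd_bound (R : Type u) [CommRing R] [IsNoetherianRing R] [IsLocalRing R] :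
    ∃ t : ℕ, ∀ (m : ℕ) (X : Type u) [AddCommGroup X] [Module R X] [Module.Finite R X],
      PdLE R m X → PdLE R t X := by
  obtain ⟨rs, hR, s, hs, hsm⟩ := exists_max_regular R
  have main : ∀ (k j : ℕ), j + k = rs.length → ∀ (m : ℕ) (X : Type u) [AddCommGroup X]
      [Module R X] [Module.Finite R X], (∀ i, i ≤ j → IsWeaklyRegular X (rs.take i)) →
      PdLE R m X → PdLE R k X := by
    intro k
    induction k with
    | zero =>
      intro j hj m X _ _ _ hX h
      refine proj_of_pd hR hs hsm m X (fun i hi => hX i (by omega)) h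
    | succ k ih =>
      intro j hj m X _ _ _ hX h
      obtain ⟨a, g, hg⟩ := exists_cover R X
      rw [pdLE_succ k g hg]
      exact ih (j + 1) (by omega) m (LinearMap.ker g) (syz_regular hR g hg j hX)
        ((pdLE_succ m g hg).1 (pdLE_mono (Nat.le_succ m) X h))
  refine ⟨rs.length, fun m X _ _ _ h => main rs.length 0 (by omega) m X (fun i hi => ?_) h⟩
  obtain rfl : i = 0 := by omega
  simp



theorem prodPow_add {R : Type u} [CommRing R] {r : ℕ} (I : Fin r → Ideal R) (m n : Fin r → ℕ) :
    prodPow I (m + n) = prodPow I m * prodPow I n := by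
  simp [prodPow, pow_add, Finset.prod_mul_distrib]

theorem prodPow_zero {R : Type u} [CommRing R] {r : ℕ} (I : Fin r → Ideal R) :
    prodPow I 0 = 1 := by
  simp [prodPow]

theorem prodPow_single {R : Type u} [CommRing R] {r : ℕ} (I : Fin r → Ideal R) (i : Fin r) :
    prodPow I (Finsupp.single i 1 : Fin r →₀ ℕ) = I i := by
  rw [prodPow, Finset.prod_eq_single i]
  · simp
  · intro j _ hj
    rw [Finsupp.single_eq_of_ne hj]; simp
  · simp

/-- The multi-Rees algebra. -/
def multiRees {R : Type u} [CommRing R] {r : ℕ} (I : Fin r → Ideal R) :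
    Subalgebra R (MvPolynomial (Fin r) R) where
  carrier := {p | ∀ n : Fin r →₀ ℕ, MvPolynomial.coeff n p ∈ prodPow I n}
  mul_mem' := by
    intro p q hp hq n
    rw [MvPolynomial.coeff_mul]
    refine Ideal.sum_mem _ fun x hx => ?_
    rw [← Finset.HasAntidiagonal.mem_antidiagonal.1 hx, Finsupp.coe_add, prodPow_add]
    exact Ideal.mul_mem_mul (hp _) (hq _)
  add_mem' := by
    intro p q hp hq n
    rw [MvPolynomial.coeff_add]
    exact add_mem (hp n) (hq n)
  algebraMap_mem' := by
    intro a n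
    rw [MvPolynomial.algebraMap_eq, MvPolynomial.coeff_C]
    split_ifs with h
    · subst h
      rw [Finsupp.coe_zero, prodPow_zero, Ideal.one_eq_top]; trivial
    · exact zero_mem _

theorem multiRees_fg {R : Type u} [CommRing R] [IsNoetherianRing R] {r : ℕ} (I : Fin r → Ideal R) :
    (multiRees I).FG := by
  classical
  have hG : ∀ i, ∃ G : Finset R, Ideal.span (G : Set R) = I i := fun i =>
    (isNoetherianRing_iff_ideal_fg R).1 ‹_› (I i)
  choose G hG using hG
  let T : Finset (MvPolynomial (Fin r) R) := Finset.univ.biUnion fun i =>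
    (G i).image fun a => MvPolynomial.monomial (Finsupp.single i 1) a
  refine ⟨T, le_antisymm ?_ ?_⟩
  · refine Algebra.adjoin_le ?_
    intro p hp
    obtain ⟨i, -, hi⟩ := Finset.mem_biUnion.1 (Finset.mem_coe.1 hp)
    obtain ⟨a, ha, rfl⟩ := Finset.mem_image.1 hi
    intro n
    rw [MvPolynomial.coeff_monomial]
    split_ifs with h
    · subst h
      rw [prodPow_single, ← hG i]
      exact Ideal.subset_span ha
    · exact zero_mem _
  · let B := Algebra.adjoin R (T : Set (MvPolynomial (Fin r) R))
    let J : (Fin r →₀ ℕ) → Ideal R := fun n =>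
      Submodule.comap (MvPolynomial.monomial n) (Subalgebra.toSubmodule B)
    have hJ : ∀ n a, a ∈ J n ↔ MvPolynomial.monomial n a ∈ B := fun n a => Iff.rfl
    have h1 : ∀ i, I i ≤ J (Finsupp.single i 1) := by
      intro i
      rw [← hG i, Ideal.span_le]
      intro a ha
      refine Algebra.subset_adjoin ?_
      exact Finset.mem_coe.2 (Finset.mem_biUnion.2 ⟨i, Finset.mem_univ _,
        Finset.mem_image.2 ⟨a, ha, rfl⟩⟩)
    have h2 : ∀ m n, J m * J n ≤ J (m + n) := by
      intro m n
      rw [Ideal.mul_le]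
      intro a ha b hb
      rw [hJ] at *
      rw [← MvPolynomial.monomial_mul]
      exact mul_mem ha hb
    have h0 : (1 : Ideal R) ≤ J 0 := by
      intro a _
      rw [hJ]
      exact B.algebraMap_mem a
    have h3 : ∀ i k, I i ^ k ≤ J (Finsupp.single i k) := by
      intro i k
      induction k with
      | zero => simpa using h0
      | succ k ih =>
        rw [pow_succ, Finsupp.single_add]
        exact (Ideal.mul_mono ih (h1 i)).trans (h2 _ _)
    have h4 : ∀ (n : Fin r →₀ ℕ) (s : Finset (Fin r)), ∏ i ∈ s, I i ^ n i ≤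
        J (∑ i ∈ s, Finsupp.single i (n i)) := by
      intro n s
      induction s using Finset.induction_on with
      | empty => simpa using h0
      | insert i s hi ih =>
        rw [Finset.prod_insert hi, Finset.sum_insert hi]
        exact (Ideal.mul_mono (h3 i _) ih).trans (h2 _ _)
    intro p hp
    rw [← MvPolynomial.support_sum_monomial_coeff p]
    refine sum_mem fun n _ => ?_
    have := h4 n Finset.univ (hp n)
    rwa [Finsupp.univ_sum_single, hJ] at this

theorem multi_artin_rees_free {R : Type u} [CommRing R] [IsNoetherianRing R] {r : ℕ}
    (I : Fin r → Ideal R) {b : ℕ} (W : Submodule R (Fin b → R)) :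
    ∃ c : Fin r → ℕ, ∀ n, c ≤ n → W ⊓ prodPow I n • ⊤ ≤
      prodPow I (n - c) • (W ⊓ prodPow I c • ⊤) := by
  classical
  let A := multiRees I
  have : Algebra.FiniteType R A := (Subalgebra.fg_iff_finiteType _).1 (multiRees_fg I)
  have hN : IsNoetherianRing A := Algebra.FiniteType.isNoetherianRing R A
  let H : Submodule A (Fin b → A) :=
    { carrier := {v | ∀ n : Fin r →₀ ℕ,
        (fun j => MvPolynomial.coeff n (v j : MvPolynomial (Fin r) R)) ∈ W}
      zero_mem' := by
        intro n
        have : (fun j => MvPolynomial.coeff n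
          (((0 : Fin b → A) j : A) : MvPolynomial (Fin r) R)) = 0 := by
          ext j; simp
        rw [this]; exact zero_mem _
      add_mem' := by
        intro v w hv hw n
        have : (fun j => MvPolynomial.coeff n
          (((v + w) j : A) : MvPolynomial (Fin r) R)) =
          (fun j => MvPolynomial.coeff n (v j : MvPolynomial (Fin r) R)) +
          (fun j => MvPolynomial.coeff n (w j : MvPolynomial (Fin r) R)) := by
          ext j; simp
        rw [this]; exact add_mem (hv n) (hw n)
      smul_mem' := by
        intro a v hv n
        have : (fun j => MvPolynomial.coeff n
          (((a • v) j : A) : MvPolynomial (Fin r) R)) =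
          ∑ x ∈ Finset.HasAntidiagonal.antidiagonal n, MvPolynomial.coeff x.1 (a : MvPolynomial (Fin r) R) •
          (fun j => MvPolynomial.coeff x.2 (v j : MvPolynomial (Fin r) R)) := by
          ext j; simp [MvPolynomial.coeff_mul]
        rw [this]; exact sum_mem fun x _ => Submodule.smul_mem _ _ (hv _) }
  have hH : ∀ v, v ∈ H ↔ ∀ n : Fin r →₀ ℕ,
        (fun j => MvPolynomial.coeff n (v j : MvPolynomial (Fin r) R)) ∈ W := fun v => Iff.rfl
  obtain ⟨S, hS⟩ : H.FG := IsNoetherian.noetherian H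
  -- bound on exponents
  let c0 : Fin r →₀ ℕ := ∑ v ∈ S, ∑ j, ∑ n ∈ (v j : MvPolynomial (Fin r) R).support, n
  have hc0 : ∀ v ∈ S, ∀ l : Fin r →₀ ℕ, ¬ l ≤ c0 → ∀ j, 
      MvPolynomial.coeff l (v j : MvPolynomial (Fin r) R) = 0 := by
    intro v hv l hl j
    by_contra hne
    apply hl
    have e1 : l ≤ ∑ n ∈ (v j : MvPolynomial (Fin r) R).support, n :=
      Finset.single_le_sum (f := fun n => n) (fun _ _ => zero_le) (MvPolynomial.mem_support_iff.2 hne)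
    have e2 := Finset.single_le_sum (f := fun j => ∑ n ∈ (v j : MvPolynomial (Fin r) R).support, n)
      (fun _ _ => zero_le) (Finset.mem_univ j)
    have e3 := Finset.single_le_sum
      (f := fun v : Fin b → A => ∑ j, ∑ n ∈ (v j : MvPolynomial (Fin r) R).support, n)
      (fun _ _ => zero_le) hv
    exact e1.trans (e2.trans e3)
  refine ⟨c0, fun n hn w hw => ?_⟩
  have hpi : ∀ (J : Ideal R) (w : Fin b → R), w ∈ (J • ⊤ : Submodule R (Fin b → R)) ↔
      ∀ j, w j ∈ J := by
    intro J w
    constructor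
    · intro hw j
      refine Submodule.smul_induction_on hw (fun a ha n _ => ?_) (fun x y hx hy => ?_)
      · exact Ideal.mul_mem_right _ _ ha
      · exact add_mem hx hy
    · intro h
      rw [pi_eq_sum_univ' w]
      exact sum_mem fun i _ => Submodule.smul_mem_smul (h i) trivial
  let n' : Fin r →₀ ℕ := Finsupp.equivFunOnFinite.symm n
  have hn' : (n' : Fin r → ℕ) = n := rfl
  obtain ⟨hwW, hwI⟩ := hw
  rw [SetLike.mem_coe, hpi] at hwI
  let v : Fin b → A := fun j => ⟨MvPolynomial.monomial n' (w j), by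
    intro l
    rw [MvPolynomial.coeff_monomial]
    split_ifs with h
    · subst h; exact hwI j
    · exact zero_mem _⟩
  have hv : v ∈ H := by
    intro l
    by_cases h : n' = l
    · subst h
      have : (fun j => MvPolynomial.coeff n' (v j : MvPolynomial (Fin r) R)) = w := by
        ext j; simp [v]
      rw [this]; exact hwW
    · have : (fun j => MvPolynomial.coeff l (v j : MvPolynomial (Fin r) R)) = 0 := by
        ext j; simp [v, MvPolynomial.coeff_monomial, h]
      rw [this]; exact zero_mem _
  have hcoef : ∀ x ∈ Submodule.span A (S : Set (Fin b → A)), 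
      (fun j => MvPolynomial.coeff n' (x j : MvPolynomial (Fin r) R)) ∈
        prodPow I (n - c0) • (W ⊓ prodPow I c0 • ⊤) := by
    intro x hx
    rw [Submodule.mem_span_finset] at hx
    obtain ⟨g, -, rfl⟩ := hx
    have key : (fun j => MvPolynomial.coeff n'
        (((∑ u ∈ S, g u • u) j : A) : MvPolynomial (Fin r) R)) =
        ∑ u ∈ S, ∑ x ∈ Finset.HasAntidiagonal.antidiagonal n',
          MvPolynomial.coeff x.1 (g u : MvPolynomial (Fin r) R) •
          (fun j => MvPolynomial.coeff x.2 (u j : MvPolynomial (Fin r) R)) := by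
      ext j
      rw [Finset.sum_apply, Finset.sum_apply, AddSubmonoidClass.coe_finsetSum,
        MvPolynomial.coeff_sum]
      refine Finset.sum_congr rfl fun u _ => ?_
      simp [MvPolynomial.coeff_mul]
    rw [key]
    refine sum_mem fun u hu => sum_mem fun x hx => ?_
    have hx := Finset.HasAntidiagonal.mem_antidiagonal.1 hx
    by_cases hl : x.2 ≤ c0
    · have hk : (x.1 : Fin r → ℕ) = (n - (c0 : Fin r → ℕ)) + ((c0 : Fin r → ℕ) - x.2) := by
        ext i
        have h1 : x.1 i + x.2 i = n i := by
          rw [← Finsupp.add_apply, hx]; rfl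
        have h2 : x.2 i ≤ c0 i := hl i
        have h3 : c0 i ≤ n i := hn i
        simp only [Pi.add_apply, Pi.sub_apply]
        omega
      have hc : (c0 : Fin r → ℕ) = ((c0 : Fin r → ℕ) - x.2) + x.2 := by
        ext i
        have h2 : x.2 i ≤ c0 i := hl i
        simp only [Pi.add_apply, Pi.sub_apply]
        omega
      have hg : MvPolynomial.coeff x.1 (g u : MvPolynomial (Fin r) R) ∈ prodPow I x.1 :=
        (g u).2 x.1
      rw [hk, prodPow_add] at hg
      have huH : u ∈ H := by rw [← hS]; exact Submodule.subset_span hu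
      have huI : (fun j => MvPolynomial.coeff x.2 (u j : MvPolynomial (Fin r) R)) ∈
          W ⊓ prodPow I x.2 • ⊤ := ⟨huH x.2, (hpi _ _).2 fun j => (u j).2 x.2⟩
      have hle : prodPow I ((c0 : Fin r → ℕ) - x.2) • (W ⊓ prodPow I x.2 • ⊤) ≤
          W ⊓ prodPow I c0 • ⊤ := by
        refine le_inf (Submodule.smul_le_right.trans inf_le_left) ?_
        conv_rhs => rw [hc, prodPow_add, mul_smul]
        exact smul_mono_right _ inf_le_right
      have := Submodule.smul_mem_smul hg huI
      rw [mul_smul] at this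
      exact smul_mono_right _ hle this
    · have : (fun j => MvPolynomial.coeff x.2 (u j : MvPolynomial (Fin r) R)) = 0 := by
        ext j; exact hc0 u hu _ hl j
      rw [this, smul_zero]; exact zero_mem _
  rw [← hS] at hv
  have := hcoef v hv
  have e : (fun j => MvPolynomial.coeff n' (v j : MvPolynomial (Fin r) R)) = w := by
    ext j; simp [v]
  rwa [e] at this



theorem multi_artin_rees {R : Type u} [CommRing R] [IsNoetherianRing R] {r : ℕ}
    (I : Fin r → Ideal R) {Q : Type u} [AddCommGroup Q] [Module R Q] [Module.Finite R Q]
    (W V : Submodule R Q) :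
    ∃ c : Fin r → ℕ, ∀ n, W ⊓ prodPow I (n + c) • V = prodPow I n • (W ⊓ prodPow I c • V) := by
  obtain ⟨b, g, hg⟩ := exists_cover R V
  let φ : (Fin b → R) →ₗ[R] Q := V.subtype ∘ₗ g
  have hφ : Submodule.map φ ⊤ = V := by
    rw [Submodule.map_top, LinearMap.range_comp, LinearMap.range_eq_top.2 hg, Submodule.map_top,
      Submodule.range_subtype]
  obtain ⟨c, hc⟩ := multi_artin_rees_free I (W.comap φ)
  refine ⟨c, fun n => le_antisymm ?_ ?_⟩
  · rintro w ⟨hw, hwI⟩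
    rw [← hφ, ← Submodule.map_smul''] at hwI
    obtain ⟨x, hx, rfl⟩ := hwI
    have h := hc (n + c) le_add_self ⟨hw, hx⟩
    rw [add_tsub_cancel_right] at h
    have h2 := Submodule.mem_map_of_mem (f := φ) h
    rw [Submodule.map_smul''] at h2
    refine Submodule.smul_mono le_rfl ?_ h2
    refine (Submodule.map_inf_le _).trans (inf_le_inf (Submodule.map_comap_le _ _) ?_)
    rw [Submodule.map_smul'', hφ]
  · refine le_inf (Submodule.smul_le_right.trans inf_le_left) ?_
    rw [prodPow_add, mul_smul]
    exact smul_mono_right _ inf_le_right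

/-- Families of submodules which are eventually of the form `U + I ^ n V`. -/
def Good {R : Type u} [CommRing R] {r : ℕ} (I : Fin r → Ideal R)
    {Q : Type u} [AddCommGroup Q] [Module R Q] (S : (Fin r → ℕ) → Submodule R Q) : Prop :=
  ∃ (c : Fin r → ℕ) (U V : Submodule R Q), ∀ n, S (n + c) = U ⊔ prodPow I n • V

section GoodFam

variable {R : Type u} [CommRing R] {r : ℕ} {I : Fin r → Ideal R}
  {P Q : Type u} [AddCommGroup P] [Module R P] [AddCommGroup Q] [Module R Q]

theorem Good.shift {S : (Fin r → ℕ) → Submodule R Q} (h : Good I S) :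
    ∃ c : Fin r → ℕ, ∀ c', c ≤ c' → ∃ U V : Submodule R Q, ∀ n,
      S (n + c') = U ⊔ prodPow I n • V := by
  obtain ⟨c, U, V, h⟩ := h
  refine ⟨c, fun c' hc => ⟨U, prodPow I (c' - c) • V, fun n => ?_⟩⟩
  rw [← mul_smul, ← prodPow_add, ← h, add_assoc, tsub_add_cancel_of_le hc]

theorem Good.const (U : Submodule R Q) : Good I (fun _ => U) :=
  ⟨0, U, ⊥, fun n => by simp⟩

theorem Good.pow (V : Submodule R Q) : Good I (fun n => prodPow I n • V) :=
  ⟨0, ⊥, V, fun n => by simp⟩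

theorem Good.map {S : (Fin r → ℕ) → Submodule R P} (h : Good I S) (φ : P →ₗ[R] Q) :
    Good I (fun n => (S n).map φ) := by
  obtain ⟨c, U, V, h⟩ := h
  exact ⟨c, U.map φ, V.map φ, fun n => by beta_reduce; rw [h, Submodule.map_sup, Submodule.map_smul'']⟩

theorem Good.sup {S T : (Fin r → ℕ) → Submodule R Q} (hS : Good I S) (hT : Good I T) :
    Good I (fun n => S n ⊔ T n) := by
  obtain ⟨c, hS⟩ := hS.shift
  obtain ⟨d, hT⟩ := hT.shift
  obtain ⟨U, V, hS⟩ := hS (c ⊔ d) le_sup_left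
  obtain ⟨U', V', hT⟩ := hT (c ⊔ d) le_sup_right
  exact ⟨c ⊔ d, U ⊔ U', V ⊔ V', fun n => by beta_reduce; rw [hS, hT, Submodule.smul_sup, sup_sup_sup_comm]⟩

theorem Good.finsetSup {ι : Type*} (s : Finset ι) {S : ι → (Fin r → ℕ) → Submodule R Q}
    (hS : ∀ i, Good I (S i)) : Good I (fun n => s.sup fun i => S i n) := by
  classical
  induction s using Finset.induction_on with
  | empty => exact Good.const ⊥
  | insert i s hi ih =>
    simp only [Finset.sup_insert]
    exact (hS i).sup ih

theorem Good.pi {b : ℕ} {S : Fin b → (Fin r → ℕ) → Submodule R Q}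
    (hS : ∀ i, Good I (S i)) :
    Good I (fun n => Submodule.pi Set.univ fun i => S i n) := by
  have := Good.finsetSup Finset.univ fun i => (hS i).map (LinearMap.single R (fun _ : Fin b => Q) i)
  simpa only [Finset.sup_univ_eq_iSup, Submodule.iSup_map_single] using this

theorem Good.comap [IsNoetherianRing R] [Module.Finite R Q]
    {S : (Fin r → ℕ) → Submodule R Q} (h : Good I S) (φ : P →ₗ[R] Q) :
    Good I (fun n => (S n).comap φ) := by
  obtain ⟨c, U, V, h⟩ := h
  let ψ : P →ₗ[R] Q ⧸ U := U.mkQ ∘ₗ φ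
  obtain ⟨d, hd⟩ := multi_artin_rees I (LinearMap.range ψ) (V.map U.mkQ)
  refine ⟨d + c, LinearMap.ker ψ,
    (LinearMap.range ψ ⊓ prodPow I d • V.map U.mkQ).comap ψ, fun n => ?_⟩
  have e1 : (S (n + (d + c))).comap φ = (prodPow I (n + d) • V.map U.mkQ).comap ψ := by
    rw [← add_assoc, h, ← Submodule.map_smul'', Submodule.comap_comp, Submodule.comap_map_mkQ]
  have e2 : (prodPow I (n + d) • V.map U.mkQ).comap ψ =
      (LinearMap.range ψ ⊓ prodPow I (n + d) • V.map U.mkQ).comap ψ := by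
    ext x; simp
  beta_reduce
  rw [e1, e2, hd]
  conv_lhs => rw [← inf_eq_right.2 (inf_le_left :
    LinearMap.range ψ ⊓ prodPow I d • V.map U.mkQ ≤ LinearMap.range ψ), ← Submodule.map_comap_eq,
    ← Submodule.map_smul'', Submodule.comap_map_eq]
  rw [sup_comm]

theorem Good.inf [IsNoetherianRing R] [Module.Finite R Q]
    {S T : (Fin r → ℕ) → Submodule R Q} (hS : Good I S) (hT : Good I T) :
    Good I (fun n => S n ⊓ T n) := by
  have := ((hS.map (LinearMap.inl R Q Q)).sup (hT.map (LinearMap.inr R Q Q))).comap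
    (LinearMap.prod LinearMap.id LinearMap.id)
  convert this using 2 with n
  ext x
  simp only [Submodule.mem_inf, Submodule.mem_comap, Submodule.mem_sup, Submodule.mem_map]
  constructor
  · rintro ⟨h1, h2⟩
    exact ⟨_, ⟨x, h1, rfl⟩, _, ⟨x, h2, rfl⟩, by simp⟩
  · rintro ⟨_, ⟨y, h1, rfl⟩, _, ⟨z, h2, rfl⟩, h⟩
    simp at h
    exact ⟨h.1 ▸ h1, h.2 ▸ h2⟩

end GoodFam

/-- Eventually constant predicates. -/
def EvConst {r : ℕ} (p : (Fin r → ℕ) → Prop) : Prop :=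
  ∃ (c : Fin r → ℕ) (b : Prop), ∀ n, c ≤ n → (p n ↔ b)

theorem EvConst.mono {r : ℕ} {p : (Fin r → ℕ) → Prop} (h : ∀ m n, m ≤ n → p m → p n) :
    EvConst p := by
  by_cases hp : ∃ m, p m
  · obtain ⟨m, hm⟩ := hp
    exact ⟨m, True, fun n hn => iff_true_intro (h m n hn hm)⟩
  · exact ⟨0, False, fun n _ => iff_false_intro fun hn => hp ⟨n, hn⟩⟩

theorem EvConst.not {r : ℕ} {p : (Fin r → ℕ) → Prop} (h : EvConst p) :
    EvConst (fun n => ¬ p n) := by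
  obtain ⟨c, b, h⟩ := h
  exact ⟨c, ¬ b, fun n hn => not_congr (h n hn)⟩

theorem EvConst.and {r : ℕ} {p q : (Fin r → ℕ) → Prop} (hp : EvConst p) (hq : EvConst q) :
    EvConst (fun n => p n ∧ q n) := by
  obtain ⟨c, b, h⟩ := hp
  obtain ⟨c', b', h'⟩ := hq
  exact ⟨c ⊔ c', b ∧ b', fun n hn => and_congr (h n (le_sup_left.trans hn))
    (h' n (le_sup_right.trans hn))⟩

theorem EvConst.anti {r : ℕ} {p : (Fin r → ℕ) → Prop} (h : ∀ m n, m ≤ n → p n → p m) :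
    EvConst p := by
  have := (EvConst.mono (p := fun n => ¬ p n) fun m n hmn hm hn => hm (h m n hmn hn)).not
  simpa using this

theorem EvConst.unshift {r : ℕ} {p : (Fin r → ℕ) → Prop} (d : Fin r → ℕ)
    (h : EvConst fun n => p (n + d)) : EvConst p := by
  obtain ⟨c, b, h⟩ := h
  refine ⟨c + d, b, fun n hn => ?_⟩
  have := h (n - d) (le_tsub_of_add_le_right hn)
  beta_reduce at this
  rwa [tsub_add_cancel_of_le (le_add_self.trans hn)] at this

theorem Good.evConst_le {R : Type u} [CommRing R] {r : ℕ} {I : Fin r → Ideal R}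
    {Q : Type u} [AddCommGroup Q] [Module R Q]
    {S T : (Fin r → ℕ) → Submodule R Q} (hS : Good I S) (hT : Good I T) :
    EvConst fun n => S n ≤ T n := by
  obtain ⟨c, hS⟩ := hS.shift
  obtain ⟨d, hT⟩ := hT.shift
  obtain ⟨U, V, hS⟩ := hS (c ⊔ d) le_sup_left
  obtain ⟨U', V', hT⟩ := hT (c ⊔ d) le_sup_right
  refine EvConst.unshift (c ⊔ d) ?_
  simp only [hS, hT, sup_le_iff]
  refine EvConst.and (EvConst.anti fun m n hmn h => h.trans (sup_le_sup_left ?_ _))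
    (EvConst.mono fun m n hmn h => ?_)
  · rw [← tsub_add_cancel_of_le hmn, prodPow_add, mul_smul]
    exact Submodule.smul_le_right
  · rw [← tsub_add_cancel_of_le hmn, prodPow_add, mul_smul, mul_smul]
    refine (smul_mono_right _ h).trans ?_
    rw [Submodule.smul_sup]
    exact sup_le_sup_right Submodule.smul_le_right _



/-- The action of a matrix on tuples of elements of a module. -/
def act {R : Type u} [CommRing R] {b c : ℕ} (A : Fin b → Fin c → R)
    (X : Type u) [AddCommGroup X] [Module R X] : (Fin b → X) →ₗ[R] (Fin c → X) :=
  LinearMap.pi fun k => ∑ j, A j k • LinearMap.proj j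

theorem act_apply {R : Type u} [CommRing R] {b c : ℕ} (A : Fin b → Fin c → R)
    (X : Type u) [AddCommGroup X] [Module R X] (x : Fin b → X) (k : Fin c) :
    act A X x k = ∑ j, A j k • x j := by
  simp [act]

theorem act_lTensor {R : Type u} [CommRing R] {b c : ℕ} (d : (Fin b → R) →ₗ[R] (Fin c → R))
    (X : Type u) [AddCommGroup X] [Module R X] (t : TensorProduct R X (Fin b → R)) :
    TensorProduct.piScalarRight R R X (Fin c) (d.lTensor X t) =
      act (fun j => d (Pi.single j 1)) X (TensorProduct.piScalarRight R R X (Fin b) t) := by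
  induction t using TensorProduct.induction_on with
  | zero => simp
  | add x y hx hy => rw [map_add, map_add, hx, hy, map_add, map_add]
  | tmul x v =>
    ext k
    rw [act_apply, LinearMap.lTensor_tmul]
    simp only [TensorProduct.piScalarRight_apply, TensorProduct.piScalarRightHom_tmul]
    conv_lhs => rw [pi_eq_sum_univ' v, map_sum, Finset.sum_apply, Finset.sum_smul]
    refine Finset.sum_congr rfl fun j _ => ?_
    rw [map_smul, Pi.smul_apply, smul_eq_mul, mul_comm, mul_smul]

theorem exists_matrices {R : Type u} [CommRing R] [IsNoetherianRing R] [IsLocalRing R]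
    {P : Type u} [AddCommGroup P] [Module R P] [Module.Finite R P] [Module.Free R P]
    (C : Submodule R P) :
    ∃ (b₀ b₁ b₂ : ℕ) (A : Fin b₂ → Fin b₁ → R) (B : Fin b₁ → Fin b₀ → R),
      ∀ (X : Type u) [AddCommGroup X] [Module R X],
        Function.Injective (C.subtype.rTensor X) ↔
          ∀ x, act B X x = 0 → ∃ z, act A X z = x := by
  obtain ⟨b₁, q, hq⟩ := exists_cover R C
  obtain ⟨b₂, p, hp⟩ := exists_cover R (LinearMap.ker q)
  let e := (Module.finBasis R P).equivFun
  let α := (LinearMap.ker q).subtype ∘ₗ p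
  let β := e.toLinearMap ∘ₗ C.subtype ∘ₗ q
  have hex : Function.Exact α q := by
    rw [LinearMap.exact_iff, LinearMap.range_comp, LinearMap.range_eq_top.2 hp, Submodule.map_top,
      Submodule.range_subtype]
  refine ⟨_, b₁, b₂, fun j => α (Pi.single j 1), fun j => β (Pi.single j 1), fun X _ _ => ?_⟩
  rw [← LinearMap.lTensor_inj_iff_rTensor_inj]
  have hexT := lTensor_exact X hex hq
  have hqT := LinearMap.lTensor_surjective X hq
  have hβ : ∀ t, β.lTensor X t = 0 ↔ C.subtype.lTensor X (q.lTensor X t) = 0 := by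
    intro t
    simp only [β, LinearMap.lTensor_comp, LinearMap.comp_apply]
    exact (e.lTensor X).map_eq_zero_iff
  have hx : ∀ t, act (fun j => β (Pi.single j 1)) X
      (TensorProduct.piScalarRight R R X (Fin b₁) t) = 0 ↔ β.lTensor X t = 0 := by
    intro t
    rw [← act_lTensor, LinearEquiv.map_eq_zero_iff]
  rw [injective_iff_map_eq_zero]
  constructor
  · intro h x hx0
    obtain ⟨t, rfl⟩ := (TensorProduct.piScalarRight R R X (Fin b₁)).surjective x
    rw [hx, hβ] at hx0
    obtain ⟨s, rfl⟩ := (hexT t).1 (h _ hx0)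
    exact ⟨_, (act_lTensor α X s).symm⟩
  · intro h y hy
    obtain ⟨t, rfl⟩ := hqT y
    rw [← hβ, ← hx] at hy
    obtain ⟨z, hz⟩ := h _ hy
    obtain ⟨s, rfl⟩ := (TensorProduct.piScalarRight R R X (Fin b₂)).surjective z
    rw [← act_lTensor] at hz
    have := (TensorProduct.piScalarRight R R X (Fin b₁)).injective hz
    rw [← this]
    exact hexT.apply_apply_eq_zero s



theorem act_natural {R : Type u} [CommRing R] {b c : ℕ} (A : Fin b → Fin c → R)
    {X Y : Type u} [AddCommGroup X] [Module R X] [AddCommGroup Y] [Module R Y]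
    (φ : X →ₗ[R] Y) (x : Fin b → X) (k : Fin c) :
    act A Y (fun j => φ (x j)) k = φ (act A X x k) := by
  simp [act_apply]

theorem subquot_exact {R : Type u} [CommRing R] {b₀ b₁ b₂ : ℕ}
    (A : Fin b₂ → Fin b₁ → R) (B : Fin b₁ → Fin b₀ → R)
    {P X : Type u} [AddCommGroup P] [Module R P] [AddCommGroup X] [Module R X]
    (S S' : Submodule R P) (τ : S →ₗ[R] X) (hτ : Function.Surjective τ)
    (hker : ∀ s : S, τ s = 0 ↔ (s : P) ∈ S') :
    (∀ x, act B X x = 0 → ∃ z, act A X z = x) ↔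
      (Submodule.pi Set.univ fun _ : Fin b₁ => S) ⊓
        (Submodule.pi Set.univ fun _ : Fin b₀ => S').comap (act B P) ≤
      (Submodule.pi Set.univ fun _ : Fin b₂ => S).map (act A P) ⊔
        Submodule.pi Set.univ fun _ : Fin b₁ => S' := by
  constructor
  · rintro h y ⟨hy, hBy⟩
    have hy : ∀ j, y j ∈ S := fun j => hy j (Set.mem_univ j)
    have hBy : ∀ k, act B P y k ∈ S' := fun k => hBy k (Set.mem_univ k)
    let ys : Fin b₁ → S := fun j => ⟨y j, hy j⟩
    obtain ⟨z, hz⟩ := h (fun j => τ (ys j)) (by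
      ext k
      rw [act_natural, Pi.zero_apply, hker]
      have := act_natural B S.subtype ys k
      rw [Submodule.subtype_apply] at this
      rw [← this]
      exact hBy k)
    choose zs hzs using fun j => hτ (z j)
    have hz' : ∀ k, y k - act A P (fun j => (zs j : P)) k ∈ S' := by
      intro k
      have h1 := congrFun hz k
      have h2 : z = fun j => τ (zs j) := funext fun j => (hzs j).symm
      rw [h2, act_natural, ← sub_eq_zero, ← map_sub, hker] at h1
      have h3 := act_natural A S.subtype zs k
      simp only [Submodule.subtype_apply] at h3
      rw [h3, ← neg_sub]
      exact neg_mem h1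
    refine Submodule.mem_sup.2 ⟨act A P (fun j => (zs j : P)),
      ⟨_, fun j _ => (zs j).2, rfl⟩, y - act A P (fun j => (zs j : P)), fun k _ => hz' k, ?_⟩
    simp
  · intro h x hx
    choose ys hys using fun j => hτ (x j)
    have h1 : (fun j => (ys j : P)) ∈ (Submodule.pi Set.univ fun _ : Fin b₁ => S) ⊓
        (Submodule.pi Set.univ fun _ : Fin b₀ => S').comap (act B P) := by
      refine ⟨fun j _ => (ys j).2, fun k _ => ?_⟩
      have h3 := act_natural B S.subtype ys k
      simp only [Submodule.subtype_apply] at h3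
      have h2 := congrFun hx k
      rw [show x = fun j => τ (ys j) from funext fun j => (hys j).symm, act_natural,
        Pi.zero_apply, hker] at h2
      rw [h3]
      exact h2
    obtain ⟨_, ⟨z, hz, rfl⟩, w, hw, hzw⟩ := Submodule.mem_sup.1 (h h1)
    let zs : Fin b₂ → S := fun j => ⟨z j, hz j (Set.mem_univ j)⟩
    refine ⟨fun j => τ (zs j), ?_⟩
    ext k
    rw [act_natural, ← hys k, ← sub_eq_zero, ← map_sub, hker]
    have h3 := act_natural A S.subtype zs k
    simp only [Submodule.subtype_apply] at h3
    have h4 := congrFun hzw k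
    rw [Pi.add_apply] at h4
    have h5 : ((act A S zs k - ys k : S) : P) = - w k := by
      rw [AddSubgroupClass.coe_sub, ← h3, ← h4]
      exact sub_add_cancel_left _ _
    rw [h5]
    exact neg_mem (hw k (Set.mem_univ k))

theorem evConst_exact {R : Type u} [CommRing R] [IsNoetherianRing R] {r : ℕ} {I : Fin r → Ideal R}
    {b₀ b₁ b₂ : ℕ} (A : Fin b₂ → Fin b₁ → R) (B : Fin b₁ → Fin b₀ → R)
    {P : Type u} [AddCommGroup P] [Module R P] [Module.Finite R P]
    (S S' : (Fin r → ℕ) → Submodule R P) (hS : Good I S) (hS' : Good I S') :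
    EvConst fun n => (Submodule.pi Set.univ fun _ : Fin b₁ => S n) ⊓
        (Submodule.pi Set.univ fun _ : Fin b₀ => S' n).comap (act B P) ≤
      (Submodule.pi Set.univ fun _ : Fin b₂ => S n).map (act A P) ⊔
        Submodule.pi Set.univ fun _ : Fin b₁ => S' n :=
  ((Good.pi fun _ => hS).inf ((Good.pi fun _ => hS').comap _)).evConst_le
    (((Good.pi fun _ => hS).map _).sup (Good.pi fun _ => hS'))



/-- Homomorphisms from a free module with values in a submodule. -/
def homInto {R : Type u} [CommRing R] {M : Type u} [AddCommGroup M] [Module R M] (b : ℕ)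
    (N : Submodule R M) : Submodule R ((Fin b → R) →ₗ[R] M) :=
  (Submodule.pi Set.univ fun _ : Fin b => N).comap
    (LinearMap.pi fun i => LinearMap.applyₗ (Pi.single i 1))

theorem mem_homInto {R : Type u} [CommRing R] {M : Type u} [AddCommGroup M] [Module R M] {b : ℕ}
    {N : Submodule R M} {h : (Fin b → R) →ₗ[R] M} : h ∈ homInto b N ↔ N.mkQ ∘ₗ h = 0 := by
  constructor
  · intro hh
    refine LinearMap.ext fun v => ?_
    rw [LinearMap.comp_apply, LinearMap.zero_apply, Submodule.mkQ_apply,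
      Submodule.Quotient.mk_eq_zero, pi_eq_sum_univ' v, map_sum]
    refine sum_mem fun i _ => ?_
    rw [map_smul]
    exact N.smul_mem _ (hh i (Set.mem_univ i))
  · intro hh i _
    have := LinearMap.congr_fun hh (Pi.single i 1)
    rwa [LinearMap.comp_apply, LinearMap.zero_apply, Submodule.mkQ_apply,
      Submodule.Quotient.mk_eq_zero] at this

theorem homInto_good {R : Type u} [CommRing R] [IsNoetherianRing R] {r : ℕ} {I : Fin r → Ideal R}
    {M : Type u} [AddCommGroup M] [Module R M] [Module.Finite R M] (b : ℕ)
    {T : (Fin r → ℕ) → Submodule R M} (hT : Good I T) : Good I (fun n => homInto b (T n)) :=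
  (Good.pi fun _ => hT).comap _

theorem exists_descent {R : Type u} [CommRing R] {a b : ℕ}
    {K X : Type u} [AddCommGroup K] [Module R K] [AddCommGroup X] [Module R X]
    (p : (Fin a → R) →ₗ[R] K) (hp : Function.Surjective p) (k : (Fin b → R) →ₗ[R] (Fin a → R))
    (hk : Function.Exact k p) (h : (Fin a → R) →ₗ[R] X) (hh : h ∘ₗ k = 0) :
    ∃ g : K →ₗ[R] X, g ∘ₗ p = h := by
  have hle : LinearMap.ker p ≤ LinearMap.ker h := by
    rw [LinearMap.exact_iff.1 hk]
    exact LinearMap.range_le_ker_iff.2 hh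
  refine ⟨(LinearMap.ker p).liftQ h hle ∘ₗ (p.quotKerEquivOfSurjective hp).symm.toLinearMap, ?_⟩
  ext1 i
  ext
  simp only [LinearMap.comp_apply, LinearEquiv.coe_coe]
  have : (p.quotKerEquivOfSurjective hp).symm (p (LinearMap.single R (fun _ => R) i 1)) =
      (LinearMap.ker p).mkQ (LinearMap.single R (fun _ => R) i 1) := by
    rw [LinearEquiv.symm_apply_eq]
    rfl
  rw [this]
  simp

theorem exists_res {R : Type u} [CommRing R] [IsNoetherianRing R]
    (K : Type u) [AddCommGroup K] [Module R K] [Module.Finite R K] :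
    ∃ (a b : ℕ) (p : (Fin a → R) →ₗ[R] K) (k : (Fin b → R) →ₗ[R] (Fin a → R)),
      Function.Surjective p ∧ Function.Exact k p := by
  obtain ⟨a, p, hp⟩ := exists_cover R K
  obtain ⟨b, g, hg⟩ := exists_cover R (LinearMap.ker p)
  refine ⟨a, b, p, (LinearMap.ker p).subtype ∘ₗ g, hp, ?_⟩
  rw [LinearMap.exact_iff, LinearMap.range_comp, LinearMap.range_eq_top.2 hg, Submodule.map_top,
      Submodule.range_subtype]

theorem exists_presentation {R : Type u} [CommRing R]
    {M K L : Type u} [AddCommGroup M] [Module R M]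
    [AddCommGroup K] [Module R K] [AddCommGroup L] [Module R L] (f : K →ₗ[R] L)
    {a b a' b' : ℕ} (p : (Fin a → R) →ₗ[R] K) (k : (Fin b → R) →ₗ[R] (Fin a → R))
    (hp : Function.Surjective p) (hk : Function.Exact k p)
    (p' : (Fin a' → R) →ₗ[R] L) (k' : (Fin b' → R) →ₗ[R] (Fin a' → R))
    (hp' : Function.Surjective p') (hk' : Function.Exact k' p')
    (F : (Fin a → R) →ₗ[R] (Fin a' → R)) (hF : p' ∘ₗ F = f ∘ₗ p) (N : Submodule R M) :
    ∃ τ : (homInto b N).comap (LinearMap.lcomp R M k) →ₗ[R] coherentApply f (M ⧸ N),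
      Function.Surjective τ ∧ ∀ s, τ s = 0 ↔ (s : (Fin a → R) →ₗ[R] M) ∈
        ((homInto b' N).comap (LinearMap.lcomp R M k')).map (LinearMap.lcomp R M F) ⊔
          homInto a N := by
  have hinj : Function.Injective (LinearMap.lcomp R (M ⧸ N) p) := by
    intro g g' h
    exact LinearMap.ext fun x => by
      obtain ⟨y, rfl⟩ := hp x
      exact LinearMap.congr_fun h y
  let G := LinearEquiv.ofInjective _ hinj
  let S := (homInto b N).comap (LinearMap.lcomp R M k)
  let σ : S →ₗ[R] LinearMap.range (LinearMap.lcomp R (M ⧸ N) p) :=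
    LinearMap.codRestrict _ (LinearMap.compRight R N.mkQ ∘ₗ S.subtype) (by
      intro s
      obtain ⟨g, hg⟩ := exists_descent p hp k hk (N.mkQ ∘ₗ (s : (Fin a → R) →ₗ[R] M)) (by
        have := mem_homInto.1 s.2
        rw [LinearMap.comp_assoc]
        exact this)
      exact ⟨g, hg⟩)
  let τ₀ : S →ₗ[R] (K →ₗ[R] M ⧸ N) := G.symm.toLinearMap ∘ₗ σ
  have hτ₀ : ∀ s : S, τ₀ s ∘ₗ p = N.mkQ ∘ₗ (s : (Fin a → R) →ₗ[R] M) := by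
    intro s
    have := G.apply_symm_apply (σ s)
    exact congrArg Subtype.val this
  refine ⟨Submodule.mkQ _ ∘ₗ τ₀, ?_, ?_⟩
  · refine (Submodule.mkQ_surjective _).comp ?_
    intro φ
    obtain ⟨h, hh⟩ := Module.projective_lifting_property N.mkQ (φ ∘ₗ p) (Submodule.mkQ_surjective _)
    have hkp : p ∘ₗ k = 0 := LinearMap.ext fun x => hk.apply_apply_eq_zero x
    refine ⟨⟨h, mem_homInto.2 ?_⟩, hinj ?_⟩
    · change N.mkQ ∘ₗ h ∘ₗ k = 0
      rw [← LinearMap.comp_assoc, hh, LinearMap.comp_assoc, hkp, LinearMap.comp_zero]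
    · change τ₀ _ ∘ₗ p = φ ∘ₗ p
      rw [hτ₀, hh]
  · intro s
    rw [LinearMap.comp_apply, Submodule.mkQ_apply, Submodule.Quotient.mk_eq_zero,
      Submodule.mem_sup]
    constructor
    · rintro ⟨g, hg⟩
      have hg : g ∘ₗ f = τ₀ s := hg
      obtain ⟨h, hh⟩ := Module.projective_lifting_property N.mkQ (g ∘ₗ p')
        (Submodule.mkQ_surjective _)
      have hkp : p' ∘ₗ k' = 0 := LinearMap.ext fun x => hk'.apply_apply_eq_zero x
      refine ⟨h ∘ₗ F, ⟨h, mem_homInto.2 ?_, rfl⟩, (s : (Fin a → R) →ₗ[R] M) - h ∘ₗ F,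
        mem_homInto.2 ?_, by abel⟩
      · change N.mkQ ∘ₗ h ∘ₗ k' = 0
        rw [← LinearMap.comp_assoc, hh, LinearMap.comp_assoc, hkp, LinearMap.comp_zero]
      · rw [LinearMap.comp_sub, ← hτ₀, ← hg, ← LinearMap.comp_assoc, hh, LinearMap.comp_assoc,
          LinearMap.comp_assoc, hF, sub_self]
    · rintro ⟨_, ⟨h, hh, rfl⟩, d, hd, hs⟩
      have hh : N.mkQ ∘ₗ h ∘ₗ k' = 0 := mem_homInto.1 hh
      obtain ⟨g, hg⟩ := exists_descent p' hp' k' hk' (N.mkQ ∘ₗ h)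
        (by rw [LinearMap.comp_assoc, hh])
      refine ⟨g, hinj ?_⟩
      change (g ∘ₗ f) ∘ₗ p = τ₀ s ∘ₗ p
      rw [hτ₀, ← hs, LinearMap.comp_add, mem_homInto.1 hd, add_zero, LinearMap.comp_assoc, ← hF,
        ← LinearMap.comp_assoc, hg]
      rfl



theorem pd_evConst {R : Type u} [CommRing R] [IsNoetherianRing R] [IsLocalRing R]
    {r : ℕ} (I : Fin r → Ideal R)
    (M : Type u) [AddCommGroup M] [Module R M] [Module.Finite R M]
    (N : Submodule R M)
    {K L : Type u} [AddCommGroup K] [Module R K] [Module.Finite R K]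
    [AddCommGroup L] [Module R L] [Module.Finite R L]
    (f : K →ₗ[R] L) (m : ℕ) :
    EvConst fun n => PdLE R m (coherentApply f (M ⧸ (prodPow I n • N : Submodule R M))) := by
  obtain ⟨a, b, p, k, hp, hk⟩ := exists_res (R := R) K
  obtain ⟨a', b', p', k', hp', hk'⟩ := exists_res (R := R) L
  obtain ⟨F, hF⟩ := Module.projective_lifting_property p' (f ∘ₗ p) hp'
  obtain ⟨P, _, _, _, _, C, hC⟩ := exists_test (R := R) m
  obtain ⟨b₀, b₁, b₂, A, B, hAB⟩ := exists_matrices C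
  have hN : Good I fun n => (prodPow I n • N : Submodule R M) := Good.pow N
  obtain ⟨c, q, hc⟩ := evConst_exact A B
    (fun n => (homInto b (prodPow I n • N : Submodule R M)).comap (LinearMap.lcomp R M k))
    (fun n => ((homInto b' (prodPow I n • N : Submodule R M)).comap
      (LinearMap.lcomp R M k')).map (LinearMap.lcomp R M F) ⊔
          homInto a (prodPow I n • N : Submodule R M))
    ((homInto_good b hN).comap _)
    ((((homInto_good b' hN).comap _).map _).sup (homInto_good a hN))
  refine ⟨c, q, fun n hn => ?_⟩
  rw [← hc n hn]
  obtain ⟨τ, hτ, hker⟩ := exists_presentation f p k hp hk p' k' hp' hk' F hF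
    (prodPow I n • N : Submodule R M)
  have hfin : Module.Finite R (coherentApply f (M ⧸ (prodPow I n • N : Submodule R M))) :=
    Module.Finite.of_surjective τ hτ
  beta_reduce
  rw [hC, hAB]
  exact subquot_exact A B _ _ τ hτ hker

theorem projDim_congr {R : Type u} [CommRing R]
    {X Y : Type u} [AddCommGroup X] [Module R X] [AddCommGroup Y] [Module R Y]
    (h : ∀ m, PdLE R m X ↔ PdLE R m Y) : projDim R X = projDim R Y := by
  unfold projDim
  simp only [ext_iff_hpd]
  unfold PdLE at h
  simp only [h]


/-- over a Noetherian local ring, `pd_R(F(M/IⁿN))` is eventually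
constant. -/
theorem stmt13 {R : Type u} [CommRing R] [IsNoetherianRing R] [IsLocalRing R]
    {r : ℕ} (hr : 1 ≤ r) (I : Fin r → Ideal R)
    (M : Type u) [AddCommGroup M] [Module R M] [Module.Finite R M]
    (N : Submodule R M)
    {K L : Type u} [AddCommGroup K] [Module R K] [Module.Finite R K]
    [AddCommGroup L] [Module R L] [Module.Finite R L]
    (f : K →ₗ[R] L) :
    ∃ c : Fin r → ℕ, ∀ n : Fin r → ℕ, c ≤ n →
      projDim R (coherentApply f (M ⧸ (prodPow I n • N : Submodule R M))) =
      projDim R (coherentApply f (M ⧸ (prodPow I c • N : Submodule R M))) := by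
  obtain ⟨t, ht⟩ := exists_pd_bound R
  choose c q hc using fun m => pd_evConst I M N f m
  have hcs : ∀ m ≤ t, c m ≤ (Finset.range (t + 1)).sup c := fun m hm =>
    Finset.le_sup (Finset.mem_range.2 (Nat.lt_succ_of_le hm))
  refine ⟨(Finset.range (t + 1)).sup c, fun n hn => projDim_congr fun m => ?_⟩
  have hfin : ∀ n, Module.Finite R
      (coherentApply f (M ⧸ (prodPow I n • N : Submodule R M))) := by
    intro n
    infer_instance
  have key : ∀ m ≤ t, (PdLE R m (coherentApply f (M ⧸ (prodPow I n • N : Submodule R M))) ↔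
      PdLE R m (coherentApply f (M ⧸ (prodPow I ((Finset.range (t + 1)).sup c) • N :
        Submodule R M)))) := fun m hm =>
    (hc m n ((hcs m hm).trans hn)).trans (hc m _ (hcs m hm)).symm
  rcases le_total m t with hm | hm
  · exact key m hm
  · constructor
    · intro h
      exact pdLE_mono hm _ ((key t le_rfl).1 (ht _ _ h))
    · intro h
      exact pdLE_mono hm _ ((key t le_rfl).2 (ht _ _ h))
end

section
/- Let (R, 𝔪) be a commutative Noetherian local ring with residue field k and r ≥ 1. Let S = ⊕_{n∈ℕ^r} S_n be a Noetherian standard ℕ^r-graded ring with S_0 = R, and let ℳ = ⊕_{n∈ℤ^r} ℳ_n be a finitely generated ℤ^r-graded S-module. Let f : K → L be an R-linear map between finitely generated R-modules and let F denote the associated coherent functor, F(X) := Hom_R(K,X) / {g ∘ f : g ∈ Hom_R(L,X)}. Fix i ≥ 0. Then there exist c ∈ ℕ^r and a polynomial P ∈ ℚ[x_1,…,x_r] such that β_i^R(F(ℳ_n)) = P(n) for all n ∈ ℤ^r with n ≥ c. -/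
universe u

open CategoryTheory

/-- The length `λ_R(X)` of an `R`-module `X`. -/
noncomputable def moduleLength (R X : Type u) [CommRing R] [AddCommGroup X]
    [Module R X] : WithBot ℕ∞ :=
  Order.krullDim (Submodule R X)

/-- The `i`-th Betti number of `X` over a local ring `(R,𝔪,k)`:
`β_i^R(X) = dim_k Tor_i^R(k, X)`, computed as the `R`-length of `Tor_i^R(k, X)`
(which coincides with its `k`-dimension since `𝔪` annihilates this module). -/
noncomputable def bettiNumber (R : Type u) [CommRing R] [IsLocalRing R] (i : ℕ)
    (X : Type u) [AddCommGroup X] [Module R X] : WithBot ℕ∞ :=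
  moduleLength R
    ↥(((Tor (ModuleCat.{u} R) i).obj
        (ModuleCat.of R (IsLocalRing.ResidueField R))).obj (ModuleCat.of R X))



lemma uni_antideriv (a : ℕ) : ∃ q : Polynomial ℚ, ∀ x : ℚ, q.eval x - q.eval (x - 1) = x ^ a := by
  refine ⟨Polynomial.C (1 / ((a : ℚ) + 1)) * (Polynomial.bernoulli (a + 1)).comp (Polynomial.X + 1), fun x => ?_⟩
  have h := Polynomial.bernoulli_eval_one_add (a + 1) x
  have h0 : (a : ℚ) + 1 ≠ 0 := by positivity
  simp only [Polynomial.eval_mul, Polynomial.eval_C, Polynomial.eval_comp, Polynomial.eval_add,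
    Polynomial.eval_X, Polynomial.eval_one, sub_add_cancel]
  rw [add_comm x 1, h]
  push_cast
  field_simp
  simp

lemma mv_antideriv {r : ℕ} (j : Fin r) (P : MvPolynomial (Fin r) ℚ) :
    ∃ G : MvPolynomial (Fin r) ℚ, ∀ n : Fin r → ℚ,
      MvPolynomial.eval n G - MvPolynomial.eval (n - Pi.single j 1) G = MvPolynomial.eval n P := by
  induction P using MvPolynomial.induction_on' with
  | monomial s a =>
    obtain ⟨q, hq⟩ := uni_antideriv (s j)
    refine ⟨MvPolynomial.C a * (∏ i ∈ Finset.univ.erase j, MvPolynomial.X i ^ s i) *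
      Polynomial.aeval (MvPolynomial.X j) q, fun n => ?_⟩
    have key : ∀ m : Fin r → ℚ, MvPolynomial.eval m (Polynomial.aeval (MvPolynomial.X j) q)
        = q.eval (m j) := by
      intro m
      have := Polynomial.hom_eval₂ q (algebraMap ℚ (MvPolynomial (Fin r) ℚ)) (MvPolynomial.eval m)
        (MvPolynomial.X j)
      rw [Polynomial.aeval_def, this]
      simp only [MvPolynomial.eval_X]
      have : (MvPolynomial.eval m).comp (algebraMap ℚ (MvPolynomial (Fin r) ℚ)) = RingHom.id ℚ :=
        Subsingleton.elim _ _
      rw [this]; rfl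
    have hp : ∏ i ∈ Finset.univ.erase j, (n - Pi.single j 1 : Fin r → ℚ) i ^ s i
        = ∏ i ∈ Finset.univ.erase j, n i ^ s i := by
      refine Finset.prod_congr rfl fun i hi => ?_
      simp [(Finset.mem_erase.1 hi).1]
    simp only [map_mul, map_prod, map_pow, MvPolynomial.eval_X, MvPolynomial.eval_C, key, hp]
    rw [MvPolynomial.eval_monomial, Finsupp.prod_fintype _ _ (by simp),
      ← Finset.prod_erase_mul _ _ (Finset.mem_univ j), ← hq (n j)]
    simp
    ring
  | add p q hp hq =>
    obtain ⟨G, hG⟩ := hp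
    obtain ⟨H, hH⟩ := hq
    refine ⟨G + H, fun n => ?_⟩
    simp only [map_add, ← hG, ← hH]
    ring

def EvPoly {r : ℕ} (h : (Fin r → ℤ) → ℚ) : Prop :=
  ∃ (c : Fin r → ℕ) (P : MvPolynomial (Fin r) ℚ), ∀ n : Fin r → ℤ, (fun i => (c i : ℤ)) ≤ n →
    h n = MvPolynomial.eval (fun i => (n i : ℚ)) P

lemma EvPoly.sub {r : ℕ} {h g : (Fin r → ℤ) → ℚ} (hh : EvPoly h) (hg : EvPoly g) :
    EvPoly (fun n => h n - g n) := by
  obtain ⟨c, P, hP⟩ := hh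
  obtain ⟨c', P', hP'⟩ := hg
  refine ⟨c ⊔ c', P - P', fun n hn => ?_⟩
  simp only []
  rw [map_sub, hP n, hP' n]
  · intro i; exact le_trans (by simp) (hn i)
  · intro i; exact le_trans (by simp) (hn i)

lemma EvPoly.shift {r : ℕ} {h : (Fin r → ℤ) → ℚ} (hh : EvPoly h) (j : Fin r) :
    EvPoly (fun n => h (n - Pi.single j 1)) := by
  obtain ⟨c, P, hP⟩ := hh
  refine ⟨c + Pi.single j 1, MvPolynomial.bind₁ (fun i => MvPolynomial.X i - MvPolynomial.C
    ((Pi.single j 1 : Fin r → ℚ) i)) P, fun n hn => ?_⟩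
  have : (fun i => (c i : ℤ)) ≤ n - Pi.single j 1 := by
    intro i
    have := hn i
    by_cases hij : i = j
    · subst hij; simp at this ⊢; linarith
    · simp [hij] at this ⊢; linarith
  simp only []
  rw [hP _ this]
  simp only [MvPolynomial.eval, MvPolynomial.eval₂Hom_bind₁]
  congr 2
  ext i
  · by_cases hij : i = j
    · subst hij; simp
    · simp [hij]

/-- If all the partial differences are eventually polynomial, so is the function. -/
lemma EvPoly.of_diff {r : ℕ} {h : (Fin r → ℤ) → ℚ}
    (hh : ∀ j, EvPoly (fun n => h n - h (n - Pi.single j 1))) : EvPoly h := by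
  classical
  choose c0 P hP using hh
  choose G hG using fun j => mv_antideriv j (P j)
  let c : Fin r → ℕ := fun i => ∑ j, c0 j i
  have hc : ∀ j i, c0 j i ≤ c i := fun j i =>
    Finset.single_le_sum (f := fun j => c0 j i) (fun _ _ => Nat.zero_le _) (Finset.mem_univ j)
  let E : MvPolynomial (Fin r) ℚ → (Fin r → ℤ) → ℚ := fun Q n => MvPolynomial.eval (fun i => (n i : ℚ)) Q
  -- one-coordinate step
  have step : ∀ (j : Fin r) (n : Fin r → ℤ), (fun i => (c i : ℤ)) ≤ n → 
      h n - h (Function.update n j (c j)) = E (G j) n - E (G j) (Function.update n j (c j)) := by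
    intro j
    have main : ∀ (t : ℕ) (n : Fin r → ℤ), (fun i => (c i : ℤ)) ≤ n → n j = c j + t → 
      h n - h (Function.update n j (c j)) = E (G j) n - E (G j) (Function.update n j (c j)) := by
      intro t
      induction t with
      | zero =>
        intro n hn hj
        have : Function.update n j (c j : ℤ) = n := by
          rw [Function.update_eq_self_iff]; simp [hj]
        rw [this]; ring
      | succ t ih =>
        intro n hn hj
        have h1 : (fun i => (c i : ℤ)) ≤ n - Pi.single j 1 := by
          intro i
          by_cases hij : i = j
          · subst hij; simp [hj]
          · simpa [hij] using hn i
        have h2 := ih _ h1 (by simp [hj]; ring)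
        have h3 : Function.update (n - Pi.single j 1) j (c j : ℤ) = Function.update n j (c j) := by
          ext i
          by_cases hij : i = j
          · subst hij; simp
          · simp [hij]
        rw [h3] at h2
        have h4 := hP j n (fun i => le_trans (Int.ofNat_le.2 (hc j i)) (hn i))
        have h5 := hG j (fun i => (n i : ℚ))
        have h6 : ((fun i => (n i : ℚ)) - Pi.single j 1) = fun i => (((n - Pi.single j 1 : Fin r → ℤ) i : ℤ) : ℚ) := by
          ext i
          by_cases hij : i = j
          · subst hij; simp
          · simp [hij]
        rw [h6] at h5
        simp only [E] at h2 ⊢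
        linarith
    intro n hn
    have := hn j
    simp only at this
    exact main (n j - c j).toNat n hn (by omega)
  have all : ∀ s : Finset (Fin r), ∃ Q : MvPolynomial (Fin r) ℚ, ∀ n : Fin r → ℤ, (fun i => (c i : ℤ)) ≤ n →
      h n - h (fun i => if i ∈ s then (c i : ℤ) else n i) = E Q n := by
    intro s
    induction s using Finset.induction_on with
    | empty => exact ⟨0, fun n _ => by simp [E]⟩
    | insert j s hjs ih =>
      obtain ⟨Q, hQ⟩ := ih
      let sub : Finset (Fin r) → MvPolynomial (Fin r) ℚ → MvPolynomial (Fin r) ℚ := fun s Q =>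
        MvPolynomial.bind₁ (fun i => if i ∈ s then MvPolynomial.C (c i : ℚ) else MvPolynomial.X i) Q
      have hsub : ∀ s Q n, E (sub s Q) n = E Q (fun i => if i ∈ s then (c i : ℤ) else n i) := by
        intro s Q n
        simp only [E, sub, MvPolynomial.eval, MvPolynomial.eval₂Hom_bind₁]
        congr 2
        ext i
        split_ifs <;> simp
      refine ⟨Q + (sub s (G j) - sub (insert j s) (G j)), fun n hn => ?_⟩
      have h1 := hQ n hn
      have h2 := step j (fun i => if i ∈ s then (c i : ℤ) else n i) (by
        intro i; simp only []; split_ifs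
        · exact le_rfl
        · exact hn i)
      have h3 : Function.update (fun i => if i ∈ s then (c i : ℤ) else n i) j (c j : ℤ)
          = fun i => if i ∈ insert j s then (c i : ℤ) else n i := by
        ext i
        by_cases hij : i = j
        · subst hij; simp
        · simp [hij]
      rw [h3, ← hsub, ← hsub] at h2
      have h4 : E (Q + (sub s (G j) - sub (insert j s) (G j))) n
        = E Q n + (E (sub s (G j)) n - E (sub (insert j s) (G j)) n) := by simp [E]
      rw [h4]
      linarith
  obtain ⟨Q, hQ⟩ := all Finset.univ
  refine ⟨c, Q + MvPolynomial.C (h fun i => (c i : ℤ)), fun n hn => ?_⟩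
  have := hQ n hn
  simp only [Finset.mem_univ, if_true, E] at this
  simp only [map_add, MvPolynomial.eval_C]
  linarith

lemma EvPoly.congr {r : ℕ} {h g : (Fin r → ℤ) → ℚ} (hh : EvPoly h) (e : ∀ n, g n = h n) :
    EvPoly g := by
  obtain rfl : g = h := funext e
  exact hh

/-- A graded module given by projections, with finitely many commuting degree-one operators,
and the ascending chain condition for stable submodules. -/
structure GrMod {R V : Type*} [CommRing R] [AddCommGroup V] [Module R V] {r : ℕ} {σ : Type*}
    (d : σ → Fin r) (x : σ → V →ₗ[R] V) (p : (Fin r → ℤ) → V →ₗ[R] V) : Prop where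
  comm : ∀ i j v, x i (x j v) = x j (x i v)
  idem : ∀ n v, p n (p n v) = p n v
  orth : ∀ m n v, m ≠ n → p m (p n v) = 0
  shift : ∀ i n v, p n (x i v) = x i (p (n - Pi.single (d i) 1) v)
  fin : ∀ v, ∃ s : Finset (Fin r → ℤ), v = ∑ n ∈ s, p n v
  acc : ∀ W : ℕ →o Submodule R V, (∀ k i v, v ∈ W k → x i v ∈ W k) → ∃ n, ∀ m, n ≤ m → W n = W m

section GrMod

variable {R V V' : Type*} [CommRing R] [AddCommGroup V] [Module R V] [AddCommGroup V'] [Module R V']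
  {r : ℕ} {σ : Type*} {d : σ → Fin r} {x : σ → V →ₗ[R] V} {p : (Fin r → ℤ) → V →ₗ[R] V}
  {x' : σ → V' →ₗ[R] V'} {p' : (Fin r → ℤ) → V' →ₗ[R] V'}

lemma GrMod.of_injective (H : GrMod d x p) (j : V' →ₗ[R] V) (hj : Function.Injective j)
    (hx : ∀ i v, j (x' i v) = x i (j v)) (hp : ∀ n v, j (p' n v) = p n (j v)) :
    GrMod d x' p' where
  comm i k v := hj (by simp only [hx, H.comm i k])
  idem n v := hj (by simp only [hp, H.idem])
  orth m n v h := hj (by simp only [hp, H.orth m n _ h, map_zero])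
  shift i n v := hj (by simp only [hp, hx, H.shift])
  fin v := by
    obtain ⟨s, hs⟩ := H.fin (j v)
    exact ⟨s, hj (by simp only [map_sum, hp]; exact hs)⟩
  acc W hW := by
    obtain ⟨n, hn⟩ := H.acc ⟨fun k => (W k).map j, fun a b h => Submodule.map_mono (W.mono h)⟩ (by
      rintro k i _ ⟨v, hv, rfl⟩
      exact ⟨x' i v, hW k i v hv, hx i v⟩)
    exact ⟨n, fun m hm => Submodule.map_injective_of_injective hj (hn m hm)⟩

lemma GrMod.of_surjective (H : GrMod d x p) (q : V →ₗ[R] V') (hq : Function.Surjective q)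
    (hx : ∀ i v, q (x i v) = x' i (q v)) (hp : ∀ n v, q (p n v) = p' n (q v)) :
    GrMod d x' p' where
  comm i k v := by obtain ⟨v, rfl⟩ := hq v; simp only [← hx, H.comm i k]
  idem n v := by obtain ⟨v, rfl⟩ := hq v; simp only [← hp, H.idem]
  orth m n v h := by obtain ⟨v, rfl⟩ := hq v; simp only [← hp, H.orth m n _ h, map_zero]
  shift i n v := by obtain ⟨v, rfl⟩ := hq v; simp only [← hp, ← hx, H.shift]
  fin v := by
    obtain ⟨v, rfl⟩ := hq v
    obtain ⟨s, hs⟩ := H.fin v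
    exact ⟨s, by simp only [← hp, ← map_sum]; exact congrArg q hs⟩
  acc W hW := by
    obtain ⟨n, hn⟩ := H.acc ⟨fun k => (W k).comap q, fun a b h => Submodule.comap_mono (W.mono h)⟩ (by
      intro k i v hv
      have : q (x i v) ∈ W k := by rw [hx]; exact hW k i _ hv
      exact this)
    exact ⟨n, fun m hm => Submodule.comap_injective_of_surjective hq (hn m hm)⟩

lemma GrMod.isNoetherian (H : GrMod d x p) (n : Fin r → ℤ) :
    IsNoetherian R (LinearMap.range (p n)) := by
  rw [← monotone_stabilizes_iff_noetherian]
  intro f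
  let E : ℕ → Submodule R V := fun k =>
    { carrier := {v | p n v ∈ (f k).map (LinearMap.range (p n)).subtype ∧
        ∀ m, ¬ n ≤ m → p m v = 0}
      add_mem' := fun {a b} ha hb => ⟨by rw [map_add]; exact add_mem ha.1 hb.1,
        fun m hm => by rw [map_add, ha.2 m hm, hb.2 m hm, add_zero]⟩
      zero_mem' := ⟨by rw [map_zero]; exact zero_mem _, fun m _ => map_zero _⟩
      smul_mem' := fun c a ha => ⟨by rw [map_smul]; exact Submodule.smul_mem _ _ ha.1,
        fun m hm => by rw [map_smul, ha.2 m hm, smul_zero]⟩ }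
  have hE : ∀ k, (E k) ⊓ LinearMap.range (p n) = (f k).map (LinearMap.range (p n)).subtype := by
    intro k
    ext v
    constructor
    · rintro ⟨⟨h1, h2⟩, ⟨w, rfl⟩⟩
      rwa [H.idem] at h1
    · intro hv
      obtain ⟨⟨_, ⟨w, rfl⟩⟩, hw, rfl⟩ := hv
      refine ⟨⟨?_, ?_⟩, ⟨w, rfl⟩⟩
      · change p n (p n w) ∈ _
        rw [H.idem]
        exact ⟨_, hw, rfl⟩
      · intro m hm
        exact H.orth m n w (by rintro rfl; exact hm le_rfl)
  obtain ⟨N, hN⟩ := H.acc ⟨E, fun a b h v hv => ⟨Submodule.map_mono (f.mono h) hv.1, hv.2⟩⟩ (by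
    intro k i v hv
    refine ⟨?_, ?_⟩
    · rw [H.shift, hv.2 _, map_zero]
      · exact zero_mem _
      · intro h
        have := h (d i)
        simp at this
    · intro m hm
      rw [H.shift, hv.2 _, map_zero]
      intro h
      refine hm (h.trans ?_)
      intro k
      by_cases hk : k = d i
      · subst hk; simp
      · simp [hk])
  refine ⟨N, fun m hm => ?_⟩
  apply Submodule.map_injective_of_injective (LinearMap.range (p n)).subtype_injective
  rw [← hE, ← hE]
  have : E N = E m := hN m hm
  rw [this]

lemma length_split (U : Submodule R V) (g : V →ₗ[R] V') :
    Module.length R U = Module.length R (U ⊓ LinearMap.ker g : Submodule R V)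
      + Module.length R (U.map g) := by
  refine Module.length_eq_add_of_exact (Submodule.inclusion inf_le_left) (g.submoduleMap U)
    (Submodule.inclusion_injective _) (g.submoduleMap_surjective U) ?_
  intro v
  constructor
  · intro h
    refine ⟨⟨v.1, v.2, ?_⟩, rfl⟩
    exact congrArg Subtype.val h
  · rintro ⟨w, rfl⟩
    exact Subtype.ext w.2.2

/-- length of the degree `n` part of `B`. -/
noncomputable def ell (p : (Fin r → ℤ) → V →ₗ[R] V) (B : Submodule R V) (n : Fin r → ℤ) : ℕ :=
  (Module.length R (B.map (p n))).toNat

lemma ell_ne_top (hfl : ∀ n, Module.length R (LinearMap.range (p n)) ≠ ⊤) (B : Submodule R V)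
    (n : Fin r → ℤ) : Module.length R (B.map (p n)) ≠ ⊤ := by
  intro h
  apply hfl n
  rw [← top_le_iff, ← h]
  exact Module.length_le_of_injective (Submodule.inclusion (LinearMap.map_le_range))
    (Submodule.inclusion_injective _)

lemma ell_coe (hfl : ∀ n, Module.length R (LinearMap.range (p n)) ≠ ⊤) (B : Submodule R V)
    (n : Fin r → ℤ) : ((ell p B n : ℕ) : ℕ∞) = Module.length R (B.map (p n)) :=
  ENat.natCast_toNat (ell_ne_top hfl B n)

/-- rank–nullity -/
lemma ell_rank (H : GrMod d x p) (hfl : ∀ n, Module.length R (LinearMap.range (p n)) ≠ ⊤)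
    (A B : Submodule R V)
    (hpA : ∀ n, ∀ v ∈ A, p n v ∈ A) (hpB : ∀ n, ∀ v ∈ B, p n v ∈ B) (i : σ) (n : Fin r → ℤ) :
    ell p B (n - Pi.single (d i) 1) + ell p A n =
      ell p (B ⊓ A.comap (x i)) (n - Pi.single (d i) 1) + ell p (A ⊔ B.map (x i)) n := by
  set n' := n - Pi.single (d i) 1 with hn'
  have memmap : ∀ (C : Submodule R V), (∀ n, ∀ v ∈ C, p n v ∈ C) → ∀ n v,
      v ∈ C.map (p n) ↔ v ∈ C ∧ p n v = v := by
    intro C hC n v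
    constructor
    · rintro ⟨w, hw, rfl⟩
      exact ⟨hC n w hw, H.idem n w⟩
    · rintro ⟨h1, h2⟩
      exact ⟨v, h1, h2⟩
  have e1 := length_split (B.map (p n')) ((A.map (p n)).mkQ ∘ₗ x i)
  have e2 := length_split ((A ⊔ B.map (x i)).map (p n)) (A.map (p n)).mkQ
  have hpK : ∀ n, ∀ v ∈ B ⊓ A.comap (x i), p n v ∈ B ⊓ A.comap (x i) := by
    rintro m v ⟨h1, h2⟩
    refine ⟨hpB m v h1, ?_⟩
    have := H.shift i (m + Pi.single (d i) 1) v
    rw [add_sub_cancel_right] at this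
    change x i (p m v) ∈ A
    rw [← this]
    exact hpA _ _ h2
  have f1 : (B.map (p n')) ⊓ LinearMap.ker ((A.map (p n)).mkQ ∘ₗ x i)
      = (B ⊓ A.comap (x i)).map (p n') := by
    ext v
    rw [memmap _ hpK, Submodule.mem_inf, memmap _ hpB, LinearMap.ker_comp, Submodule.ker_mkQ,
      Submodule.mem_comap, memmap _ hpA, H.shift, ← hn', Submodule.mem_inf, Submodule.mem_comap]
    constructor
    · rintro ⟨⟨h1, h2⟩, h3, h4⟩
      exact ⟨⟨h1, h3⟩, h2⟩
    · rintro ⟨⟨h1, h3⟩, h2⟩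
      exact ⟨⟨h1, h2⟩, h3, by rw [h2]⟩
  have f2 : (A ⊔ B.map (x i)).map (p n) ⊓ LinearMap.ker (A.map (p n)).mkQ = A.map (p n) := by
    rw [Submodule.ker_mkQ]
    exact inf_eq_right.2 (Submodule.map_mono le_sup_left)
  have f3 : (B.map (p n')).map ((A.map (p n)).mkQ ∘ₗ x i)
      = ((A ⊔ B.map (x i)).map (p n)).map (A.map (p n)).mkQ := by
    rw [Submodule.map_comp, Submodule.map_sup, Submodule.map_sup, Submodule.mkQ_map_self, bot_sup_eq,
      ← Submodule.map_comp, ← Submodule.map_comp, ← Submodule.map_comp, ← Submodule.map_comp]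
    congr 1
    ext v
    simp only [LinearMap.comp_apply, H.shift]
    rfl
  rw [f1, f3] at e1
  rw [f2] at e2
  have fin3 : Module.length R (((A ⊔ B.map (x i)).map (p n)).map (A.map (p n)).mkQ) ≠ ⊤ := by
    intro h
    rw [h] at e2
    exact ell_ne_top hfl _ _ (by rw [e2]; simp)
  rw [← ell_coe hfl, ← ell_coe hfl, ← ENat.natCast_toNat fin3] at e1 e2
  norm_cast at e1 e2
  omega

theorem hilb (H : GrMod d x p) (hfl : ∀ n, Module.length R (LinearMap.range (p n)) ≠ ⊤)
    (I : Finset σ) : ∀ A B : Submodule R V, A ≤ B →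
    (∀ i, ∀ v ∈ A, x i v ∈ A) → (∀ i, ∀ v ∈ B, x i v ∈ B) →
    (∀ n, ∀ v ∈ A, p n v ∈ A) → (∀ n, ∀ v ∈ B, p n v ∈ B) →
    (∀ i, i ∉ I → ∀ v ∈ B, x i v ∈ A) → EvPoly (fun n => (ell p B n : ℚ) - (ell p A n : ℚ)) := by
  classical
  induction I using Finset.strongInduction with
  | H I ih =>
  intro A B hAB hxA hxB hpA hpB hI
  by_cases hj : ∀ j, ∃ i ∈ I, d i = j
  · -- every direction occurs
    apply EvPoly.of_diff
    intro j
    obtain ⟨i, hi, rfl⟩ := hj j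
    have hss : I.erase i ⊂ I := Finset.erase_ssubset hi
    have K1 := ih _ hss A (B ⊓ A.comap (x i)) (le_inf hAB (fun v hv => hxA i v hv)) hxA
      (by
        rintro k v ⟨h1, h2⟩
        refine ⟨hxB k v h1, ?_⟩
        change x i (x k v) ∈ A
        rw [H.comm]
        exact hxA k _ h2) hpA
      (by
        rintro m v ⟨h1, h2⟩
        refine ⟨hpB m v h1, ?_⟩
        have := H.shift i (m + Pi.single (d i) 1) v
        rw [add_sub_cancel_right] at this
        change x i (p m v) ∈ A
        rw [← this]
        exact hpA _ _ h2)
      (by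
        intro k hk v hv
        by_cases hki : k = i
        · subst hki; exact hv.2
        · exact hI k (fun h => hk (Finset.mem_erase.2 ⟨hki, h⟩)) v hv.1)
    have K2 := ih _ hss (A ⊔ B.map (x i)) B
      (sup_le hAB (by rintro _ ⟨v, hv, rfl⟩; exact hxB i v hv))
      (by
        intro k v hv
        obtain ⟨a, ha, _, ⟨b, hb, rfl⟩, rfl⟩ := Submodule.mem_sup.1 hv
        rw [map_add, H.comm k i]
        exact add_mem (Submodule.mem_sup_left (hxA k a ha))
          (Submodule.mem_sup_right ⟨_, hxB k b hb, rfl⟩)) hxB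
      (by
        intro m v hv
        obtain ⟨a, ha, _, ⟨b, hb, rfl⟩, rfl⟩ := Submodule.mem_sup.1 hv
        rw [map_add, H.shift]
        exact add_mem (Submodule.mem_sup_left (hpA m a ha))
          (Submodule.mem_sup_right ⟨_, hpB _ b hb, rfl⟩)) hpB
      (by
        intro k hk v hv
        by_cases hki : k = i
        · subst hki; exact Submodule.mem_sup_right ⟨v, hv, rfl⟩
        · exact Submodule.mem_sup_left (hI k (fun h => hk (Finset.mem_erase.2 ⟨hki, h⟩)) v hv))
    have := K2.sub (K1.shift (d i))
    refine EvPoly.congr this fun n => ?_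
    have e := ell_rank H hfl A B hpA hpB i n
    have e' : (ell p B (n - Pi.single (d i) 1) : ℚ) + ell p A n =
      ell p (B ⊓ A.comap (x i)) (n - Pi.single (d i) 1) + ell p (A ⊔ B.map (x i)) n := by
      exact_mod_cast e
    linarith
  · -- some direction does not occur
    push Not at hj
    obtain ⟨j, hj⟩ := hj
    let D : ℕ → Submodule R V := fun N =>
      { carrier := {v | v ∈ B ∧ ∀ n : Fin r → ℤ, (N : ℤ) < n j → p n v ∈ A}
        add_mem' := fun {a b} ha hb => ⟨add_mem ha.1 hb.1, fun n hn => by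
          rw [map_add]; exact add_mem (ha.2 n hn) (hb.2 n hn)⟩
        zero_mem' := ⟨zero_mem _, fun n _ => by rw [map_zero]; exact zero_mem _⟩
        smul_mem' := fun c a ha => ⟨Submodule.smul_mem _ _ ha.1, fun n hn => by
          rw [map_smul]; exact Submodule.smul_mem _ _ (ha.2 n hn)⟩ }
    obtain ⟨N, hN⟩ := H.acc ⟨D, fun a b h v hv => ⟨hv.1, fun n hn => hv.2 n
        (lt_of_le_of_lt (by exact_mod_cast h) hn)⟩⟩ (by
      intro k i v hv
      refine ⟨hxB i v hv.1, fun n hn => ?_⟩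
      by_cases hi : i ∈ I
      · rw [H.shift]
        refine hxA i _ (hv.2 _ ?_)
        simpa [(hj i hi).symm] using hn
      · exact hpA n _ (hI i hi v hv.1))
    have hBN : ∀ v ∈ B, v ∈ D N := by
      intro v hv
      obtain ⟨s, hs⟩ := H.fin v
      let M : ℕ := s.sup (fun n => (n j).toNat)
      have h1 : v ∈ D (max N M) := by
        refine ⟨hv, fun n hn => ?_⟩
        have : n ∉ s := by
          intro hns
          have h2 : (n j).toNat ≤ M := Finset.le_sup (f := fun n : Fin r → ℤ => (n j).toNat) hns
          have h3 : (M : ℤ) ≤ (max N M : ℕ) := by exact_mod_cast le_max_right _ _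
          omega
        rw [hs, map_sum, Finset.sum_eq_zero]
        · exact zero_mem _
        · intro m hm
          exact H.orth n m v (by rintro rfl; exact this hm)
      have h2 : D N = D (max N M) := hN _ (le_max_left _ _)
      rw [h2]; exact h1
    refine ⟨Pi.single j (N + 1), 0, fun n hn => ?_⟩
    have hnj : (N : ℤ) < n j := by
      have := hn j
      simp at this
      omega
    have : B.map (p n) = A.map (p n) := by
      apply le_antisymm
      · rintro _ ⟨b, hb, rfl⟩
        exact ⟨p n b, (hBN b hb).2 n hnj, H.idem n b⟩
      · exact Submodule.map_mono hAB
    simp only [ell]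
    rw [this, sub_self, map_zero]

theorem GrMod.evPoly [Finite σ] (H : GrMod d x p)
    (hfl : ∀ n, Module.length R (LinearMap.range (p n)) ≠ ⊤) :
    EvPoly (fun n => ((Module.length R (LinearMap.range (p n))).toNat : ℚ)) := by
  classical
  cases nonempty_fintype σ
  have := hilb H hfl Finset.univ ⊥ ⊤ bot_le (by simp) (by simp) (by simp) (by simp) (by simp)
  refine EvPoly.congr this fun n => ?_
  simp only [ell]
  rw [Submodule.map_bot, Submodule.map_top, Module.length_bot]
  simp

end GrMod



section Tor
open MonoidalCategory

variable {R : Type u} [CommRing R]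

/-- The complex `Y ⊗ Q`. -/
noncomputable abbrev tc (Y : ModuleCat.{u} R) (Q : ChainComplex (ModuleCat.{u} R) ℕ) :
    ChainComplex (ModuleCat.{u} R) ℕ :=
  (((tensoringLeft (ModuleCat.{u} R)).obj Y).mapHomologicalComplex _).obj Q

noncomputable abbrev tcMap {Y Z : ModuleCat.{u} R} (f : Y ⟶ Z) (Q : ChainComplex (ModuleCat.{u} R) ℕ) :
    tc Y Q ⟶ tc Z Q :=
  (NatTrans.mapHomologicalComplex ((tensoringLeft (ModuleCat.{u} R)).map f) _).app Q

noncomputable def tcSC (S : ShortComplex (ModuleCat.{u} R)) (Q : ChainComplex (ModuleCat.{u} R) ℕ) :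
    ShortComplex (ChainComplex (ModuleCat.{u} R) ℕ) :=
  ShortComplex.mk (tcMap S.f Q) (tcMap S.g Q) (by
    ext n : 1
    change (S.f ▷ Q.X n) ≫ (S.g ▷ Q.X n) = 0
    rw [← comp_whiskerRight, S.zero]
    simp)

lemma tcSC_shortExact (S : ShortComplex (ModuleCat.{u} R)) (hS : S.ShortExact)
    (Q : ChainComplex (ModuleCat.{u} R) ℕ) (hQ : ∀ n, Module.Flat R (Q.X n)) :
    (tcSC S Q).ShortExact := by
  apply HomologicalComplex.shortExact_of_degreewise_shortExact
  intro n
  have := hQ n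
  exact hS.map_of_exact (tensorRight (Q.X n))

lemma tc_isZero (P : ModuleCat.{u} R) [Module.Flat R P] {X : ModuleCat.{u} R}
    (Q : ProjectiveResolution X) (n : ℕ) :
    Limits.IsZero ((tc P Q.complex).homology (n + 1)) := by
  rw [← HomologicalComplex.exactAt_iff_isZero_homology]
  exact Module.Flat.lTensor_shortComplex_exact P (Q.complex.sc (n+1)) (Q.complex_exactAt_succ n)

lemma res_flat {X : ModuleCat.{u} R} (Q : ProjectiveResolution X) (n : ℕ) :
    Module.Flat R (Q.complex.X n) := by
  have : Module.Projective R (Q.complex.X n) := (IsProjective.iff_projective (R := R) (Q.complex.X n)).2 (Q.projective n)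
  infer_instance

noncomputable def torIso (Y X : ModuleCat.{u} R) (Q : ProjectiveResolution X) (n : ℕ) :
    ((Tor (ModuleCat.{u} R) n).obj Y).obj X ≅ (tc Y Q.complex).homology n :=
  Q.isoLeftDerivedObj _ n

/-- dimension shifting -/
lemma tor_shift (S : ShortComplex (ModuleCat.{u} R)) (hS : S.ShortExact) [Module.Flat R S.X₂]
    (X : ModuleCat.{u} R) (n : ℕ) :
    Nonempty (((Tor (ModuleCat.{u} R) (n + 2)).obj S.X₃).obj X ≅
      ((Tor (ModuleCat.{u} R) (n + 1)).obj S.X₁).obj X) := by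
  let Q := projectiveResolution X
  have h := tcSC_shortExact S hS Q.complex (res_flat Q)
  exact ⟨torIso _ _ Q _ ≪≫ h.δIso (n+2) (n+1) (by simp) (tc_isZero _ Q _) (tc_isZero _ Q _) ≪≫
    (torIso _ _ Q _).symm⟩

noncomputable def h0 (Y : ModuleCat.{u} R) {X : ModuleCat.{u} R} (Q : ProjectiveResolution X) :
    (tc Y Q.complex).homology 0 ⟶ Y ⊗ X :=
  (tc Y Q.complex).homologyι 0 ≫ Q.fromLeftDerivedZero' ((tensoringLeft _).obj Y)

instance (Y : ModuleCat.{u} R) {X : ModuleCat.{u} R} (Q : ProjectiveResolution X) :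
    IsIso (h0 Y Q) := by
  have : Limits.PreservesFiniteColimits ((tensoringLeft (ModuleCat.{u} R)).obj Y) :=
    inferInstanceAs (Limits.PreservesFiniteColimits (tensorLeft Y))
  have h1 : IsIso ((tc Y Q.complex).homologyι 0) := 
    ChainComplex.isIso_homologyι₀ _
  unfold h0
  infer_instance

lemma h0_nat {Y Z : ModuleCat.{u} R} (f : Y ⟶ Z) {X : ModuleCat.{u} R} (Q : ProjectiveResolution X) :
    HomologicalComplex.homologyMap (tcMap f Q.complex) 0 ≫ h0 Z Q = h0 Y Q ≫ (f ▷ X) := by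
  unfold h0
  rw [HomologicalComplex.homologyι_naturality_assoc, Category.assoc]
  congr 1
  rw [← cancel_epi (HomologicalComplex.pOpcycles _ _)]
  rw [HomologicalComplex.p_opcyclesMap_assoc, ProjectiveResolution.pOpcycles_comp_fromLeftDerivedZero',
    ProjectiveResolution.pOpcycles_comp_fromLeftDerivedZero'_assoc]
  exact (whisker_exchange f (Q.π.f 0)).symm

lemma tor_one (S : ShortComplex (ModuleCat.{u} R)) (hS : S.ShortExact) [Module.Flat R S.X₂]
    (X : ModuleCat.{u} R) :
    Nonempty (((Tor (ModuleCat.{u} R) 1).obj S.X₃).obj X ≃ₗ[R]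
      LinearMap.ker (S.f.hom.rTensor X)) := by
  let Q := projectiveResolution X
  have h := tcSC_shortExact S hS Q.complex (res_flat Q)
  let δ' : (tc S.X₃ Q.complex).homology 1 ⟶ (tc S.X₁ Q.complex).homology 0 := h.δ 1 0 (by simp)
  have hmono : Mono δ' := h.mono_δ 1 0 (by simp) (tc_isZero S.X₂ Q 0)
  have hex := h.homology_exact₁ 1 0 (by simp)
  let φ : ((Tor (ModuleCat.{u} R) 1).obj S.X₃).obj X ⟶ S.X₁ ⊗ X :=
    (torIso _ _ Q _).hom ≫ δ' ≫ h0 S.X₁ Q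
  have hφ : Mono φ := by
    have : Mono (δ' ≫ h0 S.X₁ Q) := mono_comp _ _
    exact mono_comp _ _
  have hinj : Function.Injective φ.hom := (ModuleCat.mono_iff_injective φ).1 hφ
  have hnat := h0_nat S.f Q
  rw [ShortComplex.ShortExact.moduleCat_exact_iff_function_exact] at hex
  have hrange : LinearMap.range φ.hom = LinearMap.ker (S.f.hom.rTensor X) := by
    ext t
    obtain ⟨y, rfl⟩ : ∃ y, (h0 S.X₁ Q).hom y = t :=
      (ModuleCat.epi_iff_surjective (h0 S.X₁ Q)).1 inferInstance t
    have e1 : S.f.hom.rTensor X ((h0 S.X₁ Q).hom y) =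
        (h0 S.X₂ Q).hom ((HomologicalComplex.homologyMap (tcMap S.f Q.complex) 0).hom y) :=
      (congrArg (fun g => g.hom y) hnat).symm
    have inj1 := (ModuleCat.mono_iff_injective (h0 S.X₁ Q)).1 inferInstance
    have inj2 := (ModuleCat.mono_iff_injective (h0 S.X₂ Q)).1 inferInstance
    rw [LinearMap.mem_ker, e1]
    constructor
    · rintro ⟨w, hw⟩
      have : δ'.hom ((torIso _ _ Q _).hom.hom w) = y := inj1 hw
      have h2 := (hex y).2 ⟨_, this⟩
      exact (congrArg _ h2).trans (map_zero _)
    · intro hy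
      have h2 : (HomologicalComplex.homologyMap (tcMap S.f Q.complex) 0).hom y = 0 :=
        inj2 (hy.trans (map_zero (h0 S.X₂ Q).hom).symm)
      obtain ⟨w, hw⟩ := (hex y).1 h2
      obtain ⟨w', rfl⟩ := (ModuleCat.epi_iff_surjective (torIso S.X₃ X Q 1).hom).1 inferInstance w
      exact ⟨w', congrArg (h0 S.X₁ Q).hom hw⟩
  exact ⟨(LinearEquiv.ofInjective φ.hom hinj).trans (LinearEquiv.ofEq _ _ hrange)⟩

theorem tor_ker [IsNoetherianRing R] (i : ℕ) : ∀ (M : ModuleCat.{u} R) [Module.Finite R M],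
    ∃ (A P : ModuleCat.{u} R) (_ : Module.Finite R A) (j : A →ₗ[R] P), ∀ X : ModuleCat.{u} R,
      Nonempty (((Tor (ModuleCat.{u} R) i).obj M).obj X ≃ₗ[R] LinearMap.ker (j.rTensor X)) := by
  have cover : ∀ (M : ModuleCat.{u} R) [Module.Finite R M], ∃ S : ShortComplex (ModuleCat.{u} R),
      S.ShortExact ∧ Module.Flat R S.X₂ ∧ Module.Finite R S.X₁ ∧ S.X₃ = M := by
    intro M _
    obtain ⟨n, f, hf⟩ := Module.Finite.exists_fin' R M
    let g : (ULift.{u} (Fin n) → R) →ₗ[R] M := f ∘ₗ (LinearMap.funLeft R R ULift.up)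
    have hg : Function.Surjective g := hf.comp
      (LinearMap.funLeft_surjective_of_injective R R _ ULift.up_injective)
    exact ⟨g.shortComplexKer, LinearMap.shortExact_shortComplexKer hg,
      inferInstanceAs (Module.Flat R (ULift.{u} (Fin n) → R)),
      inferInstanceAs (Module.Finite R (LinearMap.ker g)), rfl⟩
  induction i with
  | zero =>
    intro M _
    refine ⟨M, ModuleCat.of R PUnit, inferInstance, 0, fun X => ?_⟩
    have : Limits.PreservesFiniteColimits ((tensoringLeft (ModuleCat.{u} R)).obj M) :=
      inferInstanceAs (Limits.PreservesFiniteColimits (tensorLeft M))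
    have e := (((tensoringLeft (ModuleCat.{u} R)).obj M).leftDerivedZeroIsoSelf.app X).toLinearEquiv
    have hk : LinearMap.ker ((0 : M →ₗ[R] (ModuleCat.of R PUnit.{u+1})).rTensor X) = ⊤ := by
      rw [LinearMap.rTensor_zero, LinearMap.ker_zero]
    exact ⟨LinearEquiv.trans e (LinearEquiv.trans Submodule.topEquiv.symm (LinearEquiv.ofEq _ _ hk.symm))⟩
  | succ i ih =>
    intro M _
    obtain ⟨S, hS, hfl, hfin, rfl⟩ := cover M
    cases i with
    | zero => exact ⟨S.X₁, S.X₂, hfin, S.f.hom, fun X => tor_one S hS X⟩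
    | succ i =>
      obtain ⟨A, P, hA, j, hj⟩ := ih S.X₁
      refine ⟨A, P, hA, j, fun X => ?_⟩
      obtain ⟨e⟩ := tor_shift S hS X i
      obtain ⟨e'⟩ := hj X
      exact ⟨e.toLinearEquiv.trans e'⟩

lemma tor_ann (Y X : ModuleCat.{u} R) (a : R) (ha : ∀ y : Y, a • y = 0) (i : ℕ)
    (t : ((Tor (ModuleCat.{u} R) i).obj Y).obj X) : a • t = 0 := by
  let Q := projectiveResolution X
  have hz : ∀ z : (tc Y Q.complex).X i, a • z = 0 := by
    intro z
    change a • (show TensorProduct R Y (Q.complex.X i) from z) = 0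
    induction (show TensorProduct R Y (Q.complex.X i) from z) using TensorProduct.induction_on with
    | zero => simp
    | tmul y q => rw [TensorProduct.smul_tmul', ha, TensorProduct.zero_tmul]
    | add p q hp hq => rw [smul_add, hp, hq, add_zero]
  have hc : ∀ z : (tc Y Q.complex).cycles i, a • z = 0 := by
    intro z
    apply (ModuleCat.mono_iff_injective ((tc Y Q.complex).iCycles i)).1 inferInstance
    exact (map_smul ((tc Y Q.complex).iCycles i).hom a z).trans
      ((hz _).trans (map_zero ((tc Y Q.complex).iCycles i).hom).symm)
  have hh : ∀ z : (tc Y Q.complex).homology i, a • z = 0 := by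
    intro z
    obtain ⟨w, rfl⟩ := (ModuleCat.epi_iff_surjective ((tc Y Q.complex).homologyπ i)).1 inferInstance z
    refine (map_smul ((tc Y Q.complex).homologyπ i).hom a w).symm.trans ?_
    rw [hc, map_zero]
  apply (torIso Y X Q i).toLinearEquiv.injective
  rw [map_smul, hh, map_zero]

end Tor


section Functor

open TensorProduct

variable {R K L : Type u} [CommRing R] [AddCommGroup K] [Module R K]
    [AddCommGroup L] [Module R L] (f : K →ₗ[R] L)
    {X Y Z : Type u} [AddCommGroup X] [Module R X] [AddCommGroup Y] [Module R Y]
    [AddCommGroup Z] [Module R Z]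

/-- Functoriality of the coherent functor. -/
noncomputable def Fmap (φ : X →ₗ[R] Y) : coherentApply f X →ₗ[R] coherentApply f Y :=
  Submodule.mapQ _ _ (LinearMap.compRight R φ) (by
    rintro _ ⟨g, rfl⟩
    exact ⟨φ ∘ₗ g, rfl⟩)

lemma Fmap_mk (φ : X →ₗ[R] Y) (g : K →ₗ[R] X) :
    Fmap f φ (Submodule.Quotient.mk g) = Submodule.Quotient.mk (φ ∘ₗ g) := rfl

lemma Fmap_id : Fmap f (LinearMap.id : X →ₗ[R] X) = LinearMap.id := by
  apply LinearMap.ext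
  intro v
  obtain ⟨g, rfl⟩ := Submodule.Quotient.mk_surjective _ v
  rw [Fmap_mk]; rfl

lemma Fmap_comp (ψ : Y →ₗ[R] Z) (φ : X →ₗ[R] Y) :
    Fmap f (ψ ∘ₗ φ) = Fmap f ψ ∘ₗ Fmap f φ := by
  apply LinearMap.ext
  intro v
  obtain ⟨g, rfl⟩ := Submodule.Quotient.mk_surjective _ v
  rfl

variable {A P : Type u} [AddCommGroup A] [Module R A] [AddCommGroup P] [Module R P]
  (j : A →ₗ[R] P)

/-- The kernel functor. -/
noncomputable def Gmap (φ : X →ₗ[R] Y) :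
    LinearMap.ker (j.rTensor (coherentApply f X)) →ₗ[R]
      LinearMap.ker (j.rTensor (coherentApply f Y)) :=
  ((Fmap f φ).lTensor A).restrict (by
    intro v hv
    rw [LinearMap.mem_ker] at hv ⊢
    rw [← LinearMap.comp_apply, LinearMap.rTensor_comp_lTensor, ← LinearMap.lTensor_comp_rTensor,
      LinearMap.comp_apply, hv, map_zero])

lemma Gmap_coe (φ : X →ₗ[R] Y) (v) : (Gmap f j φ v : A ⊗[R] _) = (Fmap f φ).lTensor A v := rfl

lemma Gmap_id (v) : Gmap f j (LinearMap.id : X →ₗ[R] X) v = v := by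
  apply Subtype.ext
  rw [Gmap_coe, Fmap_id, LinearMap.lTensor_id]; rfl

lemma Gmap_comp (ψ : Y →ₗ[R] Z) (φ : X →ₗ[R] Y) (v) :
    Gmap f j (ψ ∘ₗ φ) v = Gmap f j ψ (Gmap f j φ v) := by
  apply Subtype.ext
  rw [Gmap_coe, Gmap_coe, Gmap_coe, Fmap_comp, LinearMap.lTensor_comp]; rfl

/-- The kernel functor on a retract. -/
lemma Gmap_range (ι : X →ₗ[R] Y) (π : Y →ₗ[R] X) (h : π ∘ₗ ι = LinearMap.id) :
    Nonempty (LinearMap.range (Gmap f j (ι ∘ₗ π)) ≃ₗ[R]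
      LinearMap.ker (j.rTensor (coherentApply f X))) := by
  have h1 : ∀ v, Gmap f j π (Gmap f j ι v) = v := by
    intro v
    rw [← Gmap_comp, h, Gmap_id]
  have hi : Function.Injective (Gmap f j ι) := Function.LeftInverse.injective h1
  have hr : LinearMap.range (Gmap f j (ι ∘ₗ π)) = LinearMap.range (Gmap f j ι) := by
    apply le_antisymm
    · rintro _ ⟨v, rfl⟩
      exact ⟨_, (Gmap_comp f j ι π v).symm⟩
    · rintro _ ⟨v, rfl⟩
      refine ⟨Gmap f j ι v, ?_⟩
      rw [Gmap_comp, h1]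
  exact ⟨(LinearEquiv.ofEq _ _ hr).trans (LinearEquiv.ofInjective _ hi).symm⟩

/-- Transfer of the graded structure to the kernel functor. -/
lemma GrMod.functor [Module.Finite R K] [Module.Finite R A] {r : ℕ} {σ : Type*} {d : σ → Fin r}
    {x : σ → X →ₗ[R] X} {p : (Fin r → ℤ) → X →ₗ[R] X}
    (H : ∀ a : ℕ, ∀ b : ℕ, GrMod d (fun i => (x i).compLeft (Fin a × Fin b))
      (fun n => (p n).compLeft (Fin a × Fin b))) :
    GrMod d (fun i => Gmap f j (x i)) (fun n => Gmap f j (p n)) := by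
  obtain ⟨a, α, hα⟩ := Module.Finite.exists_fin (R := R) (M := A)
  obtain ⟨b, κ, hκ⟩ := Module.Finite.exists_fin (R := R) (M := K)
  -- homs
  let ev : (Fin a → (K →ₗ[R] X)) →ₗ[R] (Fin a × Fin b → X) :=
    { toFun := fun Φ t => Φ t.1 (κ t.2)
      map_add' := fun _ _ => rfl
      map_smul' := fun _ _ => rfl }
  have hev : Function.Injective ev := by
    intro Φ Ψ h
    funext l
    apply LinearMap.ext_on_range hκ
    intro t
    exact congrFun h (l, t)
  have H1 : GrMod d (fun i => (LinearMap.compRight R (x i) : (K →ₗ[R] X) →ₗ[R] _).compLeft (Fin a))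
      (fun n => (LinearMap.compRight R (p n) : (K →ₗ[R] X) →ₗ[R] _).compLeft (Fin a)) :=
    (H a b).of_injective ev hev (fun _ _ => rfl) (fun _ _ => rfl)
  -- tensor
  let q : (Fin a → (K →ₗ[R] X)) →ₗ[R] A ⊗[R] coherentApply f X :=
    ∑ l, (TensorProduct.mk R A (coherentApply f X) (α l)) ∘ₗ (Submodule.mkQ _) ∘ₗ LinearMap.proj l
  have hqa : ∀ Φ, q Φ = ∑ l, α l ⊗ₜ[R] (Submodule.Quotient.mk (Φ l) : coherentApply f X) := by
    intro Φ
    simp [q]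
  have hqs : Function.Surjective q := by
    rw [← LinearMap.range_eq_top, eq_top_iff, ← TensorProduct.span_tmul_eq_top, Submodule.span_le]
    rintro _ ⟨u, v, rfl⟩
    have hu : u ∈ Submodule.span R (Set.range α) := hα ▸ Submodule.mem_top
    obtain ⟨g, rfl⟩ := Submodule.Quotient.mk_surjective _ v
    obtain ⟨c, rfl⟩ := (Submodule.mem_span_range_iff_exists_fun R).1 hu
    refine ⟨fun l => c l • g, ?_⟩
    rw [hqa, TensorProduct.sum_tmul]
    refine Finset.sum_congr rfl fun l _ => ?_
    rw [Submodule.Quotient.mk_smul, TensorProduct.tmul_smul, TensorProduct.smul_tmul']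
  have hnat : ∀ (φ : X →ₗ[R] X) Φ, q ((LinearMap.compRight R φ : (K →ₗ[R] X) →ₗ[R] _).compLeft
      (Fin a) Φ) = (Fmap f φ).lTensor A (q Φ) := by
    intro φ Φ
    rw [hqa, hqa, map_sum]
    rfl
  have H2 : GrMod d (fun i => (Fmap f (x i)).lTensor A) (fun n => (Fmap f (p n)).lTensor A) :=
    H1.of_surjective q hqs (fun i v => hnat _ _) (fun i v => hnat _ _)
  exact H2.of_injective (Submodule.subtype _) (Submodule.subtype_injective _)
    (fun _ _ => rfl) (fun _ _ => rfl)

end Functor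

section Base

variable {R : Type u} [CommRing R] {r : ℕ}
    {S : Type u} [CommRing S] [Algebra R S]
    (𝒜 : (Fin r → ℕ) → Submodule R S) [GradedAlgebra 𝒜]

lemma exists_gen_comp [IsNoetherianRing S] (h0 : 𝒜 0 = 1) (e : Fin r → ℕ) :
    ∃ t : Finset S, (∀ y ∈ t, y ∈ 𝒜 e) ∧ 𝒜 e ≤ Submodule.span R (t : Set S) := by
  classical
  obtain ⟨t, ht, hts⟩ := Submodule.fg_span_iff_fg_span_finset_subset (R := S)
    (𝒜 e : Set S) |>.1 (IsNoetherian.noetherian _)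
  refine ⟨t, fun y hy => ht hy, ?_⟩
  intro y hy
  have hy' : y ∈ Submodule.span S (t : Set S) := hts ▸ Submodule.subset_span hy
  obtain ⟨c, -, hc⟩ := Submodule.mem_span_finset.1 hy'
  have h2 : y = ∑ a ∈ t, (DirectSum.decompose 𝒜 (c a) 0 : S) * a := by
    conv_lhs => rw [← DirectSum.decompose_of_mem_same 𝒜 hy, ← hc]
    rw [DirectSum.decompose_sum, DFinsupp.finsetSum_apply, AddSubmonoidClass.coe_finsetSum]
    refine Finset.sum_congr rfl fun a ha => ?_
    have := DirectSum.coe_decompose_mul_add_of_right_mem 𝒜 (i := 0) (j := e) (a := c a) (b := a)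
      (ht ha)
    rw [zero_add] at this
    exact this
  rw [h2]
  refine Submodule.sum_mem _ fun a ha => ?_
  have h3 : (DirectSum.decompose 𝒜 (c a) 0 : S) ∈ (1 : Submodule R S) := h0 ▸ SetLike.coe_mem _
  obtain ⟨z, hz⟩ := Submodule.mem_one.1 h3
  rw [← hz, ← Algebra.smul_def]
  exact Submodule.smul_mem _ _ (Submodule.subset_span ha)

lemma exists_gens [IsNoetherianRing S] (h0 : 𝒜 0 = 1)
    (hstd : ∀ n : Fin r → ℕ, 𝒜 n = ∏ i, 𝒜 (Pi.single i 1) ^ n i) :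
    ∃ (σ : Type u) (_ : Finite σ) (s : σ → S) (d : σ → Fin r),
      (∀ i, s i ∈ 𝒜 (Pi.single (d i) 1)) ∧ Algebra.adjoin R (Set.range s) = ⊤ := by
  classical
  choose t ht hts using fun j : Fin r => exists_gen_comp 𝒜 h0 (Pi.single j 1)
  refine ⟨Σ j : Fin r, t j, inferInstance, fun i => i.2.1, fun i => i.1,
    fun i => ht i.1 _ i.2.2, ?_⟩
  set B := Algebra.adjoin R (Set.range fun i : (Σ j : Fin r, t j) => i.2.1) with hB
  have h1 : ∀ j, 𝒜 (Pi.single j 1) ≤ Subalgebra.toSubmodule B := by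
    intro j
    refine (hts j).trans (Submodule.span_le.2 ?_)
    intro y hy
    exact Algebra.subset_adjoin ⟨⟨j, ⟨y, hy⟩⟩, rfl⟩
  have h1' : (1 : Submodule R S) ≤ Subalgebra.toSubmodule B := by
    rw [Submodule.one_le]; exact B.one_mem
  have hmul : ∀ U W : Submodule R S, U ≤ Subalgebra.toSubmodule B → W ≤ Subalgebra.toSubmodule B →
      U * W ≤ Subalgebra.toSubmodule B := fun U W hU hW =>
    Submodule.mul_le.2 fun a ha b hb => B.mul_mem (hU ha) (hW hb)
  have hpow : ∀ (U : Submodule R S), U ≤ Subalgebra.toSubmodule B → ∀ n : ℕ,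
      U ^ n ≤ Subalgebra.toSubmodule B := by
    intro U hU n
    induction n with
    | zero => rw [pow_zero]; exact h1'
    | succ n ih => rw [pow_succ]; exact hmul _ _ ih hU
  have h2 : ∀ n, 𝒜 n ≤ Subalgebra.toSubmodule B := by
    intro n
    rw [hstd n]
    exact Finset.prod_induction _ (fun U => U ≤ Subalgebra.toSubmodule B) hmul h1'
      (fun j _ => hpow _ (h1 j) _)
  rw [eq_top_iff]
  intro y _
  rw [← DirectSum.sum_support_decompose 𝒜 y]
  exact Subalgebra.sum_mem _ fun n _ => h2 n (SetLike.coe_mem _)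

variable {ℳ : Type u} [AddCommGroup ℳ] [Module R ℳ] [Module S ℳ]
    [IsScalarTower R S ℳ]
    (ℬ : (Fin r → ℤ) → Submodule R ℳ) [hdec : DirectSum.Decomposition ℬ]

/-- Projection to a component. -/
noncomputable def compPi (n : Fin r → ℤ) : ℳ →ₗ[R] ℬ n :=
  DirectSum.component R _ _ n ∘ₗ (DirectSum.decomposeLinearEquiv ℬ).toLinearMap

lemma compPi_apply (n) (v : ℳ) : compPi ℬ n v = DirectSum.decompose ℬ v n := rfl

/-- The projection as an endomorphism. -/
noncomputable def compP (n : Fin r → ℤ) : ℳ →ₗ[R] ℳ := (ℬ n).subtype ∘ₗ compPi ℬ n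

lemma compP_apply (n) (v : ℳ) : compP ℬ n v = (DirectSum.decompose ℬ v n : ℳ) := rfl

/-- multiplication operator -/
noncomputable def mulOp (ℳ : Type u) [AddCommGroup ℳ] [Module R ℳ] [Module S ℳ]
    [IsScalarTower R S ℳ] (s : S) : ℳ →ₗ[R] ℳ := Algebra.lsmul R R ℳ s

lemma mulOp_apply (s : S) (v : ℳ) : mulOp (R := R) ℳ s v = s • v := rfl

lemma compP_smul (hsmul : ∀ (m : Fin r → ℕ) (n : Fin r → ℤ) (s : S) (x : ℳ),
      s ∈ 𝒜 m → x ∈ ℬ n → s • x ∈ ℬ (fun i => n i + m i)) (s : S) (k : Fin r)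
    (hs : s ∈ 𝒜 (Pi.single k 1)) (n : Fin r → ℤ) (v : ℳ) :
    compP ℬ n (s • v) = s • compP ℬ (n - Pi.single k 1) v := by
  classical
  induction v using DirectSum.Decomposition.inductionOn ℬ with
  | zero => simp
  | add a b ha hb => simp only [smul_add, map_add, ha, hb]
  | @homogeneous m a =>
    have h1 : s • (a : ℳ) ∈ ℬ (m + Pi.single k 1) := by
      convert hsmul _ _ s a hs a.2 using 2
      funext t
      by_cases h : t = k
      · subst h; simp
      · simp [Pi.single_eq_of_ne h]
    rw [compP_apply, compP_apply]
    by_cases h : m + Pi.single k 1 = n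
    · subst h
      rw [DirectSum.decompose_of_mem_same ℬ h1, add_sub_cancel_right,
        DirectSum.decompose_of_mem_same ℬ a.2]
    · rw [DirectSum.decompose_of_mem_ne ℬ h1 h, DirectSum.decompose_of_mem_ne ℬ a.2, smul_zero]
      intro h'
      exact h (by rw [h', sub_add_cancel])

lemma GrMod.base [IsNoetherianRing S] [Module.Finite S ℳ]
    (hsmul : ∀ (m : Fin r → ℕ) (n : Fin r → ℤ) (s : S) (x : ℳ),
      s ∈ 𝒜 m → x ∈ ℬ n → s • x ∈ ℬ (fun i => n i + m i)) {σ : Type u} (s : σ → S)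
    (d : σ → Fin r) (hs : ∀ i, s i ∈ 𝒜 (Pi.single (d i) 1))
    (hadj : Algebra.adjoin R (Set.range s) = ⊤) (I : Type) [Finite I] :
    GrMod d (fun i => (mulOp (R := R) ℳ (s i)).compLeft I) (fun n => (compP ℬ n).compLeft I) where
  comm i k v := by
    funext t
    exact smul_comm (s i) (s k) (v t)
  idem n v := by
    funext t
    exact DirectSum.decompose_of_mem_same ℬ (SetLike.coe_mem _)
  orth m n v h := by
    funext t
    exact DirectSum.decompose_of_mem_ne ℬ (SetLike.coe_mem _) h.symm
  shift i n v := by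
    funext t
    exact compP_smul 𝒜 ℬ hsmul (s i) (d i) (hs i) n (v t)
  fin v := by
    classical
    have := Fintype.ofFinite I
    refine ⟨Finset.univ.biUnion fun t => (DirectSum.decompose ℬ (v t)).support, ?_⟩
    funext t
    rw [Finset.sum_apply]
    change v t = ∑ n ∈ _, (DirectSum.decompose ℬ (v t) n : ℳ)
    conv_lhs => rw [← DirectSum.sum_support_decompose ℬ (v t)]
    apply Finset.sum_subset
    · exact Finset.subset_biUnion_of_mem (fun t => (DirectSum.decompose ℬ (v t)).support)
        (Finset.mem_univ t)
    · intro n _ hn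
      rw [DFinsupp.notMem_support_iff] at hn
      rw [hn]; rfl
  acc W hW := by
    have hst : ∀ k (a : S) (v : I → ℳ), v ∈ W k → a • v ∈ W k := by
      intro k a
      have ha : a ∈ Algebra.adjoin R (Set.range s) := hadj ▸ Algebra.mem_top
      induction ha using Algebra.adjoin_induction with
      | mem a ha =>
        obtain ⟨i, rfl⟩ := ha
        exact fun v hv => hW k i v hv
      | algebraMap c =>
        intro v hv
        rw [algebraMap_smul]
        exact (W k).smul_mem c hv
      | add a b _ _ iha ihb =>
        intro v hv
        rw [add_smul]
        exact (W k).add_mem (iha v hv) (ihb v hv)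
      | mul a b _ _ iha ihb =>
        intro v hv
        rw [mul_smul]
        exact iha _ (ihb v hv)
    let W' : ℕ →o Submodule S (I → ℳ) :=
      ⟨fun k => { (W k).toAddSubmonoid with smul_mem' := fun a v hv => hst k a v hv },
        fun a b h v hv => W.mono h hv⟩
    obtain ⟨n, hn⟩ := monotone_stabilizes_iff_noetherian.2
      (inferInstance : IsNoetherian S (I → ℳ)) W'
    refine ⟨n, fun m hm => ?_⟩
    ext v
    exact SetLike.ext_iff.1 (hn m hm) v

end Base

/-- A Noetherian module killed by the maximal ideal has finite length. -/
lemma length_ne_top_of_killed {R M : Type u} [CommRing R] [IsLocalRing R] [AddCommGroup M]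
    [Module R M] [IsNoetherian R M]
    (h : ∀ a ∈ IsLocalRing.maximalIdeal R, ∀ v : M, a • v = 0) : Module.length R M ≠ ⊤ := by
  have : IsLocalRing.maximalIdeal R ≤ Module.annihilator R M := by
    intro a ha
    rw [Module.mem_annihilator]
    exact h a ha
  have ht : Module.IsTorsionBySet R M (IsLocalRing.maximalIdeal R : Set R) :=
    fun v a => h a.1 a.2 v
  let := ht.module
  let : Field (R ⧸ IsLocalRing.maximalIdeal R) := Ideal.Quotient.field _
  have hfin : Module.Finite (R ⧸ IsLocalRing.maximalIdeal R) M :=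
    Module.Finite.of_restrictScalars_finite R _ _
  have hart : IsArtinian (R ⧸ IsLocalRing.maximalIdeal R) M := inferInstance
  have hst : IsScalarTower R (R ⧸ IsLocalRing.maximalIdeal R) M := ht.isScalarTower
  have : IsArtinian R M := isArtinian_of_surjective_algebraMap
    (Ideal.Quotient.mk_surjective (I := IsLocalRing.maximalIdeal R))
  exact Module.length_ne_top

/-- over a Noetherian local ring `R`, the Betti numbers `β_i^R(F(ℳ_n))`
of the coherent functor applied to graded components are eventually given by a
polynomial in `n`. -/
theorem stmt15 {R : Type u} [CommRing R] [IsNoetherianRing R] [IsLocalRing R]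
    {r : ℕ} (hr : 1 ≤ r)
    -- the Noetherian standard ℕ^r-graded ring S with S₀ = R
    (S : Type u) [CommRing S] [Algebra R S] [IsNoetherianRing S]
    (hinj : Function.Injective (algebraMap R S))
    (𝒜 : (Fin r → ℕ) → Submodule R S) [GradedAlgebra 𝒜]
    (h0 : 𝒜 0 = 1)
    (hstd : ∀ n : Fin r → ℕ, 𝒜 n = ∏ i, 𝒜 (Pi.single i 1) ^ n i)
    -- the finitely generated ℤ^r-graded S-module ℳ with components ℬ n
    (ℳ : Type u) [AddCommGroup ℳ] [Module R ℳ] [Module S ℳ]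
    [IsScalarTower R S ℳ] [Module.Finite S ℳ]
    (ℬ : (Fin r → ℤ) → Submodule R ℳ) (hdec : DirectSum.Decomposition ℬ)
    (hsmul : ∀ (m : Fin r → ℕ) (n : Fin r → ℤ) (s : S) (x : ℳ),
      s ∈ 𝒜 m → x ∈ ℬ n → s • x ∈ ℬ (fun i => n i + m i))
    -- the coherent functor
    {K L : Type u} [AddCommGroup K] [Module R K] [Module.Finite R K]
    [AddCommGroup L] [Module R L] [Module.Finite R L]
    (f : K →ₗ[R] L) (i : ℕ) :
    ∃ (c : Fin r → ℕ) (P : MvPolynomial (Fin r) ℚ),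
      ∀ n : Fin r → ℤ, (fun i => (c i : ℤ)) ≤ n →
        ∃ m : ℕ,
          bettiNumber R i (coherentApply f (ℬ n)) = m ∧
          (m : ℚ) = MvPolynomial.eval (fun i => (n i : ℚ)) P := by
  obtain ⟨σ, hσ, s, d, hs, hadj⟩ := exists_gens 𝒜 h0 hstd
  let k := ModuleCat.of R (IsLocalRing.ResidueField R)
  have hk : Module.Finite R k :=
    Module.Finite.of_surjective (Algebra.linearMap R (IsLocalRing.ResidueField R))
      IsLocalRing.residue_surjective
  obtain ⟨A, P, hA, j, hj⟩ := tor_ker i k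
  have H := GrMod.functor (R := R) f j (d := d) (x := fun t => mulOp (R := R) ℳ (s t))
    (p := compP ℬ) (fun a b => GrMod.base 𝒜 ℬ hsmul s d hs hadj (Fin a × Fin b))
  have he : ∀ n, Nonempty ((((Tor (ModuleCat.{u} R) i).obj k).obj
      (ModuleCat.of R (coherentApply f (ℬ n)))) ≃ₗ[R]
      LinearMap.range (Gmap f j (compP ℬ n))) := by
    intro n
    obtain ⟨e1⟩ := hj (ModuleCat.of R (coherentApply f (ℬ n)))
    obtain ⟨e2⟩ := Gmap_range f j (ℬ n).subtype (compPi ℬ n) (by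
      apply LinearMap.ext
      intro v
      apply Subtype.ext
      exact DirectSum.decompose_of_mem_same ℬ v.2)
    exact ⟨e1.trans e2.symm⟩
  have hfl : ∀ n, Module.length R (LinearMap.range (Gmap f j (compP ℬ n))) ≠ ⊤ := by
    intro n
    have := H.isNoetherian n
    obtain ⟨e⟩ := he n
    apply length_ne_top_of_killed
    intro a ha v
    apply e.symm.injective
    rw [map_smul, map_zero]
    apply tor_ann
    intro y
    obtain ⟨z, rfl⟩ := IsLocalRing.residue_surjective (R := R) y
    change a • (algebraMap R (IsLocalRing.ResidueField R) z) = 0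
    rw [Algebra.smul_def, IsLocalRing.ResidueField.algebraMap_eq,
      (IsLocalRing.residue_eq_zero_iff a).2 ha, zero_mul]
  obtain ⟨c, Q, hQ⟩ := H.evPoly hfl
  refine ⟨c, Q, fun n hn => ⟨_, ?_, hQ n hn⟩⟩
  obtain ⟨e⟩ := he n
  have hl : Module.length R (((Tor (ModuleCat.{u} R) i).obj k).obj
      (ModuleCat.of R (coherentApply f (ℬ n)))) =
      Module.length R (LinearMap.range (Gmap f j (compP ℬ n))) := LinearEquiv.length_eq e
  rw [bettiNumber, moduleLength, ← Module.coe_length]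
  change ((Module.length R (((Tor (ModuleCat.{u} R) i).obj k).obj
      (ModuleCat.of R (coherentApply f (ℬ n)))) : ℕ∞) : WithBot ℕ∞) = _
  rw [hl]
  conv_lhs => rw [← ENat.natCast_toNat (hfl n)]
  rfl
end
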